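/- arXiv:2405.16543 — 11 statements merged into one kernel-verified Lean document; each statement's English description precedes it below -/
import Mathlib

section
/- Fix N ≥ 1, an initial state x₀ ∈ ℝⁿ, and tree inputs u^w ∈ ℝ^m for every word w of depth at most N−1. Define tree states by x^∅ = x₀ and x^{w·i} = Ā_i x^w + B̄_i u^w for every word w of depth at most N−1 and every i ∈ {1,…,d}. Given an admissible uncertainty sequence (α_t), define weights β^∅ = 1 and β^{w·i} = α_{|w|,i} β^w. Let the plant evolve as x_{t+1} = A_t x_t + B_t u_t for t = 0,…,N−1 with x_0 = x₀ and u_t = Σ_{|w|=t} β^w u^w. Then for every t ∈ {0,1,…,N} the weights β^w with |w| = t are nonnegative and sum to 1, and x_t = Σ_{|w|=t} β^w x^w; in particular x_t lies in the convex hull of the tree states of depth t. -/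
open Matrix

/-- Euclidean norm on `Fin n → ℝ`. -/
noncomputable def eNorm {n : ℕ} (x : Fin n → ℝ) : ℝ := Real.sqrt (∑ i, x i ^ 2)

theorem sum_fin_snoc {M ι : Type*} [AddCommMonoid M] [Fintype ι] (t : ℕ)
    (f : (Fin (t + 1) → ι) → M) :
    ∑ w, f w = ∑ i, ∑ w : Fin t → ι, f (Fin.snoc w i) := by
  rw [← Fintype.sum_prod_type', ← (Fin.snocEquiv fun _ => ι).sum_comp]
  rfl

theorem stmt_0 (n m d : ℕ) (hn : 0 < n) (hm : 0 < m) (hd : 0 < d)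
    (Abar : Fin d → Matrix (Fin n) (Fin n) ℝ)
    (Bbar : Fin d → Matrix (Fin n) (Fin m) ℝ)
    (N : ℕ) (hN : 1 ≤ N)
    (x0 : Fin n → ℝ)
    -- tree inputs
    (u : ∀ t : ℕ, (Fin t → Fin d) → (Fin m → ℝ))
    -- tree states
    (X : ∀ t : ℕ, (Fin t → Fin d) → (Fin n → ℝ))
    (hX0 : ∀ w : Fin 0 → Fin d, X 0 w = x0)
    (hXs : ∀ t, t < N → ∀ (w : Fin t → Fin d) (i : Fin d),
      X (t + 1) (Fin.snoc w i) = (Abar i).mulVec (X t w) + (Bbar i).mulVec (u t w))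
    -- admissible uncertainty sequence
    (α : ℕ → Fin d → ℝ)
    (hα : ∀ t i, 0 ≤ α t i) (hαs : ∀ t, ∑ i, α t i = 1)
    -- weights
    (β : ∀ t : ℕ, (Fin t → Fin d) → ℝ)
    (hβ0 : ∀ w : Fin 0 → Fin d, β 0 w = 1)
    (hβs : ∀ (t : ℕ) (w : Fin t → Fin d) (i : Fin d),
      β (t + 1) (Fin.snoc w i) = α t i * β t w)
    -- plant trajectory
    (x : ℕ → Fin n → ℝ)
    (hx0 : x 0 = x0)
    (hxs : ∀ t, t < N →
      x (t + 1) = (∑ i, α t i • Abar i).mulVec (x t)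
        + (∑ i, α t i • Bbar i).mulVec (∑ w : Fin t → Fin d, β t w • u t w)) :
    ∀ t, t ≤ N →
      (∀ w : Fin t → Fin d, 0 ≤ β t w) ∧
      (∑ w : Fin t → Fin d, β t w) = 1 ∧
      x t = ∑ w : Fin t → Fin d, β t w • X t w ∧
      x t ∈ convexHull ℝ (Set.range (X t)) := by
  suffices key : ∀ t, t ≤ N →
      (∀ w : Fin t → Fin d, 0 ≤ β t w) ∧
      (∑ w : Fin t → Fin d, β t w) = 1 ∧
      x t = ∑ w : Fin t → Fin d, β t w • X t w by
    intro t ht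
    obtain ⟨h0, h1, hx⟩ := key t ht
    refine ⟨h0, h1, hx, ?_⟩
    rw [hx]
    exact (convex_convexHull ℝ _).sum_mem (fun w _ => h0 w) h1
      fun w _ => subset_convexHull ℝ _ (Set.mem_range_self w)
  intro t
  induction t with
  | zero => exact fun _ => ⟨fun w => by simp [hβ0], by simp [hβ0], by simp [hβ0, hX0, hx0]⟩
  | succ t ih =>
    intro ht
    obtain ⟨h0, h1, hx⟩ := ih (by lia)
    refine ⟨fun w => ?_, ?_, ?_⟩
    · rw [← Fin.snoc_init_self w, hβs]
      exact mul_nonneg (hα _ _) (h0 _)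
    · simp only [sum_fin_snoc, hβs, ← Finset.mul_sum, h1, mul_one, hαs]
    · simp only [sum_fin_snoc, hβs, hXs t ht, hxs t ht, hx, Matrix.sum_mulVec,
        Matrix.smul_mulVec, Matrix.mulVec_sum, Matrix.mulVec_smul, smul_add, mul_smul,
        Finset.smul_sum, Finset.sum_add_distrib]
      congr 1 <;>
      · rw [Finset.sum_comm]
        exact Finset.sum_congr rfl fun i _ => Finset.sum_congr rfl fun w _ => smul_comm _ _ _
end

section
/- Fix N ≥ 1, an initial state x₀ ∈ ℝⁿ with x₀ ≠ 0, and tree inputs u^w ∈ ℝ^m for every word w of depth at most N−1. Define tree states by x^∅ = x₀ and x^{w·i} = Ā_i x^w + B̄_i u^w for every word w of depth at most N−1 and every i ∈ {1,…,d}. Let P₀ ∈ ℝ^{n×n} be symmetric and positive definite, and assume x^wᵀ P₀ x^w < x₀ᵀ P₀ x₀ for every word w of depth N. Then for every admissible uncertainty sequence (α_t), the plant trajectory x_{t+1} = A_t x_t + B_t u_t with x_0 = x₀ and u_t = Σ_{|w|=t} β^w u^w (where β^∅ = 1 and β^{w·i} = α_{|w|,i} β^w) satisfies x_Nᵀ P₀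 x_N < x₀ᵀ P₀ x₀. -/
open Matrix

theorem Matrix.PosSemidef.convexOn_dotProduct_mulVec {ι : Type*} [Fintype ι]
    {P : Matrix ι ι ℝ} (hP : P.PosSemidef) :
    ConvexOn ℝ Set.univ fun v : ι → ℝ => v ⬝ᵥ P.mulVec v := by
  refine ⟨convex_univ, fun v _ w _ a b ha hb hab => ?_⟩
  have h : 0 ≤ (v - w) ⬝ᵥ P.mulVec (v - w) := by
    simpa using hP.dotProduct_mulVec_nonneg (v - w)
  obtain rfl : b = 1 - a := by linarith
  have hprod := mul_nonneg (mul_nonneg ha hb) h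
  simp only [mulVec_add, mulVec_sub, mulVec_smul, dotProduct_add, add_dotProduct,
    dotProduct_sub, sub_dotProduct, dotProduct_smul, smul_dotProduct, smul_eq_mul] at hprod ⊢
  linarith

theorem Fin.sum_pi_succ_eq_sum_snoc {ι M : Type*} [Fintype ι] [AddCommMonoid M] (t : ℕ)
    (f : (Fin (t + 1) → ι) → M) :
    ∑ w, f w = ∑ w : Fin t → ι, ∑ i, f (Fin.snoc w i) := by
  rw [← (Fin.snocEquiv fun _ => ι).sum_comp, Fintype.sum_prod_type_right]
  rfl

section TreeWeights

variable {d : ℕ} {α : ℕ → Fin d → ℝ} {β : ∀ t : ℕ, (Fin t → Fin d) → ℝ}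

theorem treeWeight_nonneg (hα : ∀ t i, 0 ≤ α t i) (hβ0 : ∀ w : Fin 0 → Fin d, β 0 w = 1)
    (hβs : ∀ (t : ℕ) (w : Fin t → Fin d) (i : Fin d),
      β (t + 1) (Fin.snoc w i) = α t i * β t w) (t : ℕ) (w : Fin t → Fin d) : 0 ≤ β t w := by
  induction t with
  | zero => simp [hβ0]
  | succ t ih =>
    rw [← Fin.snoc_init_self w, hβs]
    exact mul_nonneg (hα t _) (ih _)

theorem sum_treeWeight (hαs : ∀ t, ∑ i, α t i = 1) (hβ0 : ∀ w : Fin 0 → Fin d, β 0 w = 1)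
    (hβs : ∀ (t : ℕ) (w : Fin t → Fin d) (i : Fin d),
      β (t + 1) (Fin.snoc w i) = α t i * β t w) (t : ℕ) : ∑ w, β t w = 1 := by
  induction t with
  | zero => simp [hβ0]
  | succ t ih =>
    simp_rw [Fin.sum_pi_succ_eq_sum_snoc, hβs, ← Finset.sum_mul, hαs, one_mul, ih]

end TreeWeights

theorem sum_smul_mulVec_sum_smul {ι κ p q : Type*} [Fintype ι] [Fintype κ] [Fintype q]
    (a : ι → ℝ) (b : κ → ℝ) (A : ι → Matrix p q ℝ) (v : κ → q → ℝ) :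
    (∑ i, a i • A i).mulVec (∑ w, b w • v w) =
      ∑ w, ∑ i, (a i * b w) • (A i).mulVec (v w) := by
  simp_rw [mulVec_sum, sum_mulVec, smul_mulVec, mulVec_smul, smul_smul]

theorem stmt_1 (n m d : ℕ) (hn : 0 < n) (hm : 0 < m) (hd : 0 < d)
    (Abar : Fin d → Matrix (Fin n) (Fin n) ℝ)
    (Bbar : Fin d → Matrix (Fin n) (Fin m) ℝ)
    (N : ℕ) (hN : 1 ≤ N)
    (x0 : Fin n → ℝ) (hx0ne : x0 ≠ 0)
    -- tree inputs
    (u : ∀ t : ℕ, (Fin t → Fin d) → (Fin m → ℝ))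
    -- tree states
    (X : ∀ t : ℕ, (Fin t → Fin d) → (Fin n → ℝ))
    (hX0 : ∀ w : Fin 0 → Fin d, X 0 w = x0)
    (hXs : ∀ t, t < N → ∀ (w : Fin t → Fin d) (i : Fin d),
      X (t + 1) (Fin.snoc w i) = (Abar i).mulVec (X t w) + (Bbar i).mulVec (u t w))
    -- the quadratic finite-step decrease along every scenario
    (P0 : Matrix (Fin n) (Fin n) ℝ) (hP0 : P0.PosDef)
    (hdec : ∀ w : Fin N → Fin d,
      X N w ⬝ᵥ P0.mulVec (X N w) < x0 ⬝ᵥ P0.mulVec x0)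
    -- admissible uncertainty sequence
    (α : ℕ → Fin d → ℝ)
    (hα : ∀ t i, 0 ≤ α t i) (hαs : ∀ t, ∑ i, α t i = 1)
    -- weights
    (β : ∀ t : ℕ, (Fin t → Fin d) → ℝ)
    (hβ0 : ∀ w : Fin 0 → Fin d, β 0 w = 1)
    (hβs : ∀ (t : ℕ) (w : Fin t → Fin d) (i : Fin d),
      β (t + 1) (Fin.snoc w i) = α t i * β t w)
    -- plant trajectory
    (x : ℕ → Fin n → ℝ)
    (hx0 : x 0 = x0)
    (hxs : ∀ t, t < N →
      x (t + 1) = (∑ i, α t i • Abar i).mulVec (x t)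
        + (∑ i, α t i • Bbar i).mulVec (∑ w : Fin t → Fin d, β t w • u t w)) :
    x N ⬝ᵥ P0.mulVec (x N) < x0 ⬝ᵥ P0.mulVec x0 := by
  have hx : ∀ t, t ≤ N → x t = ∑ w : Fin t → Fin d, β t w • X t w := by
    intro t
    induction t with
    | zero => simp [hx0, hβ0, hX0]
    | succ t ih =>
      intro ht
      rw [hxs t ht, ih (Nat.le_of_succ_le ht), Fin.sum_pi_succ_eq_sum_snoc,
        sum_smul_mulVec_sum_smul, sum_smul_mulVec_sum_smul]
      simp_rw [hXs t ht, hβs, smul_add, Finset.sum_add_distrib]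
  have hmem := (hP0.posSemidef.convexOn_dotProduct_mulVec.convex_lt
    (x0 ⬝ᵥ P0.mulVec x0)).sum_mem (t := Finset.univ)
      (fun w _ => treeWeight_nonneg hα hβ0 hβs N w) (sum_treeWeight hαs hβ0 hβs N)
      (fun w _ => ⟨Set.mem_univ (X N w), hdec w⟩)
  rw [hx N le_rfl]
  exact hmem.2
end

section
/- Let K ∈ ℝ^{m×n}. Suppose there exist N ≥ 1 and symmetric positive definite matrices P^w ∈ ℝ^{n×n} for every word w of depth at most N−1, with P^∅ = P₀, such that: (i) P^w ≻ (Ā_i + B̄_i K)ᵀ P^{w·i} (Ā_i + B̄_i K) for every word w of depth at most N−2 and every i ∈ {1,…,d}; and (ii) P^w ≻ (Ā_i + B̄_i K)ᵀ P₀ (Ā_i + B̄_i K) for every word w of depth exactly N−1 and every i ∈ {1,…,d}. Then there exist c ≥ 1 and λ ∈ (0,1) such that for every x₀ ∈ ℝⁿ and every admissible uncertainty sequence, the closed-loop trajectory x_{t+1} = (A_t + B_t K) x_t with x_0 = x₀ satisfies ‖x_t‖ ≤ c λ^t ‖x₀‖ for all t ∈ ℕ. -/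
open Matrix

/-- A positive semidefinite matrix `M` induces the seminorm `x ↦ √(xᵀ M x)`. -/
theorem Matrix.PosSemidef.exists_seminorm {n : ℕ} {M : Matrix (Fin n) (Fin n) ℝ}
    (hM : M.PosSemidef) :
    ∃ p : Seminorm ℝ (Fin n → ℝ), ∀ x, p x = √(x ⬝ᵥ M *ᵥ x) := by
  let := M.toSeminormedAddCommGroup hM
  let := M.toInnerProductSpace hM
  refine ⟨normSeminorm ℝ (Fin n → ℝ), fun x => ?_⟩
  change √((M *ᵥ x) ⬝ᵥ star x) = _
  rw [dotProduct_comm, star_trivial]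

/-- The ratio of a seminorm to a norm on `ℝⁿ` attains its maximum. -/
theorem Seminorm.exists_forall_mul_le_mul {n : ℕ} (hn : 0 < n) (p q : Seminorm ℝ (Fin n → ℝ))
    (hp : ∀ x, x ≠ 0 → 0 < p x) :
    ∃ y, y ≠ 0 ∧ ∀ x, q x ≤ q y / p y * p x := by
  have hcont (r : Seminorm ℝ (Fin n → ℝ)) : Continuous r :=
    continuousOn_univ.1 (r.convexOn.continuousOn isOpen_univ)
  have : Nonempty (Fin n) := ⟨⟨0, hn⟩⟩
  have hne : ∀ x ∈ Metric.sphere (0 : Fin n → ℝ) 1, x ≠ 0 := fun x hx =>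
    ne_zero_of_mem_unit_sphere ⟨x, hx⟩
  obtain ⟨y, hy, hmax⟩ := (isCompact_sphere (0 : Fin n → ℝ) 1).exists_isMaxOn
    (NormedSpace.sphere_nonempty.2 zero_le_one)
    ((hcont q).continuousOn.div (hcont p).continuousOn fun x hx => (hp x (hne x hx)).ne')
  refine ⟨y, hne y hy, fun x => ?_⟩
  rcases eq_or_ne x 0 with rfl | hx
  · simp
  have hmem : ‖x‖⁻¹ • x ∈ Metric.sphere (0 : Fin n → ℝ) 1 := by
    simp [norm_smul, hx]
  have h : q (‖x‖⁻¹ • x) / p (‖x‖⁻¹ • x) ≤ q y / p y := hmax hmem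
  have hx' : ‖x‖⁻¹ ≠ 0 := inv_ne_zero (norm_ne_zero_iff.2 hx)
  rw [map_smul_eq_mul, map_smul_eq_mul, mul_div_mul_left _ _ (norm_ne_zero_iff.2 hx'),
    div_le_iff₀ (hp x hx)] at h
  exact h

/-- The largest value of `p` after `k` steps of the switched linear system with modes `M`. -/
noncomputable def switchedSeminorm {n d : ℕ} (M : Fin d → Matrix (Fin n) (Fin n) ℝ)
    (p : Seminorm ℝ (Fin n → ℝ)) : ℕ → Seminorm ℝ (Fin n → ℝ)
  | 0 => p
  | k + 1 => Finset.univ.sup fun i => (switchedSeminorm M p k).comp (M i).mulVecLin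

/-- One step of a convex combination of the modes is dominated by one switched step. -/
theorem switchedSeminorm_sum_mulVec_le {n d : ℕ} (M : Fin d → Matrix (Fin n) (Fin n) ℝ)
    (p : Seminorm ℝ (Fin n → ℝ)) (k : ℕ) {a : Fin d → ℝ} (ha : ∀ i, 0 ≤ a i)
    (hsum : ∑ i, a i = 1) (x : Fin n → ℝ) :
    switchedSeminorm M p k ((∑ i, a i • M i) *ᵥ x) ≤ switchedSeminorm M p (k + 1) x := by
  have hx : (∑ i, a i • M i) *ᵥ x = ∑ i, a i • (M i *ᵥ x) := by
    simp only [sum_mulVec, smul_mulVec]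
  rw [hx]
  calc switchedSeminorm M p k (∑ i, a i • (M i *ᵥ x))
      ≤ ∑ i, a i • switchedSeminorm M p k (M i *ᵥ x) :=
        (switchedSeminorm M p k).convexOn.map_sum_le (fun i _ => ha i) hsum fun _ _ => trivial
    _ ≤ ∑ i, a i • switchedSeminorm M p (k + 1) x := by
        refine Finset.sum_le_sum fun i _ => smul_le_smul_of_nonneg_left ?_ (ha i)
        exact Seminorm.le_finset_sup_apply (p := fun i =>
          (switchedSeminorm M p k).comp (M i).mulVecLin) (Finset.mem_univ i)
    _ = switchedSeminorm M p (k + 1) x := by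
        rw [← Finset.sum_smul, hsum, one_smul]

theorem Matrix.sqrt_dotProduct_mulVec_lt {n : ℕ} {P Q A : Matrix (Fin n) (Fin n) ℝ}
    (hP : P.PosDef) (h : (P - Aᵀ * Q * A).PosDef) {x : Fin n → ℝ} (hx : x ≠ 0) :
    √((A *ᵥ x) ⬝ᵥ Q *ᵥ (A *ᵥ x)) < √(x ⬝ᵥ P *ᵥ x) := by
  have hpos := hP.dotProduct_mulVec_pos hx
  have hlt := h.dotProduct_mulVec_pos hx
  rw [star_trivial] at hpos hlt
  refine (Real.sqrt_lt_sqrt_iff_of_pos hpos).2 ?_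
  have heq : x ⬝ᵥ (Aᵀ * Q * A) *ᵥ x = (A *ᵥ x) ⬝ᵥ Q *ᵥ (A *ᵥ x) := by
    rw [← mulVec_mulVec, ← mulVec_mulVec, dotProduct_mulVec, vecMul_transpose]
  rw [sub_mulVec, dotProduct_sub, heq] at hlt
  linarith

/-- The matrix inequalities along a scenario tree of depth `N` make `N` switched steps strictly
decrease the root seminorm. -/
theorem switchedSeminorm_lt_of_tree {n d N : ℕ} (M : Fin d → Matrix (Fin n) (Fin n) ℝ)
    {P0 : Matrix (Fin n) (Fin n) ℝ} {P : ∀ t : ℕ, (Fin t → Fin d) → Matrix (Fin n) (Fin n) ℝ}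
    (hPpos : ∀ t, t < N → ∀ w : Fin t → Fin d, (P t w).PosDef)
    (h1 : ∀ t, t + 2 ≤ N → ∀ (w : Fin t → Fin d) (i : Fin d),
      (P t w - (M i)ᵀ * P (t + 1) (Fin.snoc w i) * M i).PosDef)
    (h2 : ∀ (w : Fin (N - 1) → Fin d) (i : Fin d), (P (N - 1) w - (M i)ᵀ * P0 * M i).PosDef)
    {p : Seminorm ℝ (Fin n → ℝ)} (hp : ∀ x, p x = √(x ⬝ᵥ P0 *ᵥ x)) (k : ℕ) :
    ∀ t, t + (k + 1) = N → ∀ (w : Fin t → Fin d) (x : Fin n → ℝ), x ≠ 0 →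
      switchedSeminorm M p (k + 1) x < √(x ⬝ᵥ P t w *ᵥ x) := by
  induction k with
  | zero =>
    intro t ht w x hx
    obtain rfl : t = N - 1 := by omega
    have hP := hPpos (N - 1) (by omega) w
    have hpos := hP.dotProduct_mulVec_pos hx
    rw [star_trivial] at hpos
    refine Seminorm.finset_sup_apply_lt (Real.sqrt_pos.2 hpos) fun i _ => ?_
    change p (M i *ᵥ x) < _
    rw [hp]
    exact sqrt_dotProduct_mulVec_lt hP (h2 w i) hx
  | succ k ih =>
    intro t ht w x hx
    have hP := hPpos t (by omega) w
    have hpos := hP.dotProduct_mulVec_pos hx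
    rw [star_trivial] at hpos
    refine Seminorm.finset_sup_apply_lt (Real.sqrt_pos.2 hpos) fun i _ => ?_
    change switchedSeminorm M p (k + 1) (M i *ᵥ x) < _
    refine lt_of_le_of_lt ?_ (sqrt_dotProduct_mulVec_lt hP (h1 t (by omega) w i) hx)
    rcases eq_or_ne (M i *ᵥ x) 0 with h0 | h0
    · rw [h0, map_zero]
      exact Real.sqrt_nonneg _
    · exact (ih (t + 1) (by omega) (Fin.snoc w i) _ h0).le

/-- A strict decrease of a norm over `N` switched steps gives a function equivalent to the norms
on `ℝⁿ` that contracts at every step of every convex combination of the modes. -/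
theorem exists_contracting_of_switchedSeminorm_lt {n d N : ℕ} (hn : 0 < n) (hN : 1 ≤ N)
    (M : Fin d → Matrix (Fin n) (Fin n) ℝ) {p : Seminorm ℝ (Fin n → ℝ)}
    (hp : ∀ x, x ≠ 0 → 0 < p x) (hlt : ∀ x, x ≠ 0 → switchedSeminorm M p N x < p x) :
    ∃ γ ∈ Set.Ioo (0 : ℝ) 1, ∃ C : ℝ, ∃ V : (Fin n → ℝ) → ℝ,
      (∀ x, p x ≤ V x) ∧ (∀ x, V x ≤ C * p x) ∧
      ∀ a : Fin d → ℝ, (∀ i, 0 ≤ a i) → ∑ i, a i = 1 → ∀ x,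
        V ((∑ i, a i • M i) *ᵥ x) ≤ γ * V x := by
  obtain ⟨ρ, hρ0, hρ1, hρ⟩ : ∃ ρ : ℝ, 0 < ρ ∧ ρ < 1 ∧
      ∀ x, switchedSeminorm M p N x ≤ ρ * p x := by
    obtain ⟨y, hy, h⟩ := p.exists_forall_mul_le_mul hn (switchedSeminorm M p N) hp
    refine ⟨max (switchedSeminorm M p N y / p y) (1 / 2), by positivity,
      max_lt ((div_lt_one (hp y hy)).2 (hlt y hy)) (by norm_num), fun x => (h x).trans ?_⟩
    exact mul_le_mul_of_nonneg_right (le_max_left _ _) (apply_nonneg p x)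
  have hC (k : ℕ) : ∃ C, ∀ x, switchedSeminorm M p k x ≤ C * p x := by
    obtain ⟨y, -, h⟩ := p.exists_forall_mul_le_mul hn (switchedSeminorm M p k) hp
    exact ⟨_, h⟩
  choose C hC using hC
  set γ : ℝ := ρ ^ ((N : ℝ)⁻¹)
  have hγ0 : 0 < γ := Real.rpow_pos_of_pos hρ0 _
  have hγ1 : γ < 1 := Real.rpow_lt_one hρ0.le hρ1 (by positivity)
  have hγN : γ ^ N = ρ := Real.rpow_inv_natCast_pow hρ0.le (by omega)
  refine ⟨γ, ⟨hγ0, hγ1⟩, ∑ k ∈ Finset.range N, γ⁻¹ ^ k * C k,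
    fun x => ∑ k ∈ Finset.range N, γ⁻¹ ^ k * switchedSeminorm M p k x, ?_, ?_, ?_⟩
  · intro x
    have h := Finset.single_le_sum (f := fun k => γ⁻¹ ^ k * switchedSeminorm M p k x)
      (fun k _ => mul_nonneg (by positivity) (apply_nonneg _ x)) (Finset.mem_range.2 hN)
    simpa [switchedSeminorm] using h
  · intro x
    rw [Finset.sum_mul]
    refine Finset.sum_le_sum fun k _ => ?_
    rw [mul_assoc]
    exact mul_le_mul_of_nonneg_left (hC k x) (by positivity)
  · intro a ha hsum x
    have hstep : ∑ k ∈ Finset.range N,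
          γ⁻¹ ^ k * switchedSeminorm M p k ((∑ i, a i • M i) *ᵥ x) ≤
        γ * ∑ k ∈ Finset.range N, γ⁻¹ ^ (k + 1) * switchedSeminorm M p (k + 1) x := by
      rw [Finset.mul_sum]
      refine Finset.sum_le_sum fun k _ => ?_
      rw [← mul_assoc, pow_succ', mul_inv_cancel_left₀ hγ0.ne']
      exact mul_le_mul_of_nonneg_left (switchedSeminorm_sum_mulVec_le M p k ha hsum x)
        (by positivity)
    refine hstep.trans (mul_le_mul_of_nonneg_left ?_ hγ0.le)
    have htel := (Finset.sum_range_succ' (fun k => γ⁻¹ ^ k * switchedSeminorm M p k x) N).symm.trans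
      (Finset.sum_range_succ _ N)
    have hlast : γ⁻¹ ^ N * switchedSeminorm M p N x ≤ p x := by
      rw [inv_pow, hγN, inv_mul_le_iff₀ hρ0]
      exact hρ x
    simp only [pow_zero, one_mul, switchedSeminorm] at htel hlast ⊢
    linarith

theorem stmt_2 (n m d : ℕ) (hn : 0 < n) (hm : 0 < m) (hd : 0 < d)
    (Abar : Fin d → Matrix (Fin n) (Fin n) ℝ)
    (Bbar : Fin d → Matrix (Fin n) (Fin m) ℝ)
    (K : Matrix (Fin m) (Fin n) ℝ)
    (N : ℕ) (hN : 1 ≤ N)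
    (P0 : Matrix (Fin n) (Fin n) ℝ)
    (P : ∀ t : ℕ, (Fin t → Fin d) → Matrix (Fin n) (Fin n) ℝ)
    (hP0 : ∀ w : Fin 0 → Fin d, P 0 w = P0)
    (hPpos : ∀ t, t < N → ∀ w : Fin t → Fin d, (P t w).PosDef)
    (h1 : ∀ t, t + 2 ≤ N → ∀ (w : Fin t → Fin d) (i : Fin d),
      (P t w - (Abar i + Bbar i * K)ᵀ * P (t + 1) (Fin.snoc w i) *
        (Abar i + Bbar i * K)).PosDef)
    (h2 : ∀ (w : Fin (N - 1) → Fin d) (i : Fin d),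
      (P (N - 1) w - (Abar i + Bbar i * K)ᵀ * P0 * (Abar i + Bbar i * K)).PosDef) :
    ∃ c : ℝ, 1 ≤ c ∧ ∃ lam : ℝ, lam ∈ Set.Ioo (0 : ℝ) 1 ∧
      ∀ (α : ℕ → Fin d → ℝ), (∀ t i, 0 ≤ α t i) → (∀ t, ∑ i, α t i = 1) →
      ∀ x : ℕ → Fin n → ℝ,
        (∀ t, x (t + 1) =
          ((∑ i, α t i • Abar i) + (∑ i, α t i • Bbar i) * K).mulVec (x t)) →
        ∀ t, eNorm (x t) ≤ c * lam ^ t * eNorm (x 0) := by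
  set M : Fin d → Matrix (Fin n) (Fin n) ℝ := fun i => Abar i + Bbar i * K
  have hP0pos : P0.PosDef := hP0 Fin.elim0 ▸ hPpos 0 hN Fin.elim0
  obtain ⟨p, hp⟩ := hP0pos.posSemidef.exists_seminorm
  have hp_pos (x : Fin n → ℝ) (hx : x ≠ 0) : 0 < p x := by
    rw [hp]
    exact Real.sqrt_pos.2 (hP0pos.dotProduct_mulVec_pos hx)
  have hlt (x : Fin n → ℝ) (hx : x ≠ 0) : switchedSeminorm M p N x < p x := by
    have h := switchedSeminorm_lt_of_tree M hPpos h1 h2 hp (N - 1) 0 (by omega) Fin.elim0 x hx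
    rwa [hP0, ← hp, Nat.sub_add_cancel hN] at h
  obtain ⟨γ, hγ, D, V, hpV, hVp, hV⟩ := exists_contracting_of_switchedSeminorm_lt hn hN M hp_pos hlt
  obtain ⟨e, he⟩ := (PosDef.one (n := Fin n) (R := ℝ)).posSemidef.exists_seminorm
  have heNorm (x : Fin n → ℝ) : eNorm x = e x := by
    simp [he, eNorm, dotProduct, sq]
  have he_pos (x : Fin n → ℝ) (hx : x ≠ 0) : 0 < e x := by
    rw [he]
    exact Real.sqrt_pos.2 (PosDef.one.dotProduct_mulVec_pos hx)
  obtain ⟨y, hy, hep⟩ := p.exists_forall_mul_le_mul hn e hp_pos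
  obtain ⟨z, hz, hpe⟩ := e.exists_forall_mul_le_mul hn p he_pos
  have hD : 0 ≤ D := by
    have := (hpV y).trans (hVp y)
    nlinarith [hp_pos y hy]
  refine ⟨max 1 (e y / p y * (D * (p z / e z))), le_max_left _ _, γ, hγ, ?_⟩
  intro α hα hsum x hx t
  have hdyn (t : ℕ) : x (t + 1) = (∑ i, α t i • M i) *ᵥ x t := by
    rw [hx t]
    simp [M, Finset.sum_add_distrib, Matrix.sum_mul]
  have hVt : V (x t) ≤ γ ^ t * V (x 0) := by
    induction t with
    | zero => simp
    | succ t ih =>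
      rw [hdyn t, pow_succ', mul_assoc]
      exact (hV _ (hα t) (hsum t) _).trans (mul_le_mul_of_nonneg_left ih hγ.1.le)
  have hγt : 0 ≤ γ ^ t := pow_nonneg hγ.1.le t
  have hy0 : 0 ≤ e y / p y := div_nonneg (apply_nonneg e y) (apply_nonneg p y)
  rw [heNorm, heNorm]
  calc e (x t) ≤ e y / p y * p (x t) := hep _
    _ ≤ e y / p y * (γ ^ t * (D * (p z / e z * e (x 0)))) := by
        refine mul_le_mul_of_nonneg_left ((hpV _).trans (hVt.trans ?_)) hy0
        refine mul_le_mul_of_nonneg_left ((hVp _).trans ?_) hγt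
        exact mul_le_mul_of_nonneg_left (hpe _) hD
    _ = e y / p y * (D * (p z / e z)) * γ ^ t * e (x 0) := by ring
    _ ≤ max 1 (e y / p y * (D * (p z / e z))) * γ ^ t * e (x 0) := by
        gcongr
        exact le_max_right _ _
end

section
/- Suppose there exist N ≥ 1, matrices G ∈ ℝ^{n×n} and L ∈ ℝ^{m×n}, and symmetric positive definite matrices S^w ∈ ℝ^{n×n} for every word w of depth at most N−1 (write S₀ = S^∅), such that the 2n×2n block matrices [[Gᵀ + G − S^w, (Ā_i G + B̄_i L)ᵀ], [Ā_i G + B̄_i L, S^{w·i}]] are positive definite for every word w of depth at most N−2 and every i ∈ {1,…,d}, and the block matrices [[Gᵀ + G − S^w, (Ā_i G + B̄_i L)ᵀ], [Ā_i G + B̄_i L, S₀]] are positive definite for every word w of depth exactly N−1 and every i ∈ {1,…,d}. Then G is invertible and, setting K = L G⁻¹, there exist c ≥ 1 and λ ∈ (0,1) such that for every x₀ ∈ ℝⁿ and every admissible uncertainty sequence, the closed-loop trajectory x_{t+1} = (A_t + B_t K) x_t with x_0 = x₀ satisfies ‖x_t‖ ≤ c λ^t ‖x₀‖ for all t ∈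 ℕ. -/
open Matrix

namespace Matrix

variable {p q : Type*} [Fintype p] [Fintype q]

theorem exists_dotProduct_mulVec_self_le (B : Matrix p q ℝ) :
    ∃ C : ℝ, 0 < C ∧ ∀ z : q → ℝ, B *ᵥ z ⬝ᵥ B *ᵥ z ≤ C * (z ⬝ᵥ z) := by
  refine ⟨(∑ i, ∑ j, B i j ^ 2) + 1, by positivity, fun z => ?_⟩
  have hz : 0 ≤ z ⬝ᵥ z := Finset.sum_nonneg fun _ _ => mul_self_nonneg _
  have h : B *ᵥ z ⬝ᵥ B *ᵥ z ≤ (∑ i, ∑ j, B i j ^ 2) * (z ⬝ᵥ z) := by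
    rw [dotProduct, Finset.sum_mul]
    refine Finset.sum_le_sum fun i _ => ?_
    have := Finset.sum_mul_sq_le_sq_mul_sq Finset.univ (B i) z
    simpa [mulVec, dotProduct, sq] using this
  linarith

open scoped MatrixOrder Matrix.Norms.L2Operator in
theorem PosSemidef.exists_factor {M : Matrix p p ℝ} (hM : M.PosSemidef) :
    ∃ B : Matrix p p ℝ, ∀ z, z ⬝ᵥ M *ᵥ z = B *ᵥ z ⬝ᵥ B *ᵥ z := by
  classical
  obtain ⟨B, rfl⟩ := CStarAlgebra.nonneg_iff_eq_star_mul_self.mp hM.nonneg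
  refine ⟨B, fun z => ?_⟩
  rw [← mulVec_mulVec, dotProduct_mulVec, star_eq_conjTranspose,
    conjTranspose_eq_transpose_of_trivial, vecMul_transpose]

theorem PosSemidef.exists_upper_bound {M : Matrix p p ℝ} (hM : M.PosSemidef) :
    ∃ b : ℝ, 0 < b ∧ ∀ z, z ⬝ᵥ M *ᵥ z ≤ b * (z ⬝ᵥ z) := by
  obtain ⟨B, hB⟩ := hM.exists_factor
  simpa only [hB] using exists_dotProduct_mulVec_self_le B

theorem PosDef.exists_lower_bound {M : Matrix p p ℝ} (hM : M.PosDef) :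
    ∃ s : ℝ, 0 < s ∧ ∀ z, s * (z ⬝ᵥ z) ≤ z ⬝ᵥ M *ᵥ z := by
  classical
  obtain ⟨B, hB⟩ := hM.posSemidef.exists_factor
  have hu : IsUnit B := by
    rw [← mulVec_injective_iff_isUnit]
    refine (injective_iff_map_eq_zero B.mulVecLin).mpr fun z hz => ?_
    by_contra hne
    have := hM.dotProduct_mulVec_pos hne
    simp only [star_trivial, hB] at this
    simp_all
  obtain ⟨C, hC, h⟩ := exists_dotProduct_mulVec_self_le B⁻¹
  refine ⟨C⁻¹, inv_pos.mpr hC, fun z => ?_⟩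
  have := h (B *ᵥ z)
  rw [mulVec_mulVec, nonsing_inv_mul _ ((isUnit_iff_isUnit_det B).mp hu), one_mulVec] at this
  rw [hB, inv_mul_le_iff₀ hC]
  exact this

end Matrix

section QuadraticForms

variable {n : ℕ}

/-- The quadratic form of the block matrix `[[Gᵀ + G - T, Mᵀ], [M, T']]` dominates `ε ‖u‖²`. -/
def BlockMargin (ε : ℝ) (G T M T' : Matrix (Fin n) (Fin n) ℝ) : Prop :=
  ∀ u v : Fin n → ℝ,
    ε * (u ⬝ᵥ u) ≤ 2 * (u ⬝ᵥ G *ᵥ u) - u ⬝ᵥ T *ᵥ u + 2 * (v ⬝ᵥ M *ᵥ u) + v ⬝ᵥ T' *ᵥ v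

theorem BlockMargin.mono {ε ε' : ℝ} {G T M T' : Matrix (Fin n) (Fin n) ℝ} (hε : ε' ≤ ε)
    (h : BlockMargin ε G T M T') : BlockMargin ε' G T M T' := fun u v =>
  (mul_le_mul_of_nonneg_right hε (Finset.sum_nonneg fun _ _ => mul_self_nonneg _)).trans (h u v)

theorem exists_blockMargin_of_posDef {G T M T' : Matrix (Fin n) (Fin n) ℝ}
    (h : (fromBlocks (Gᵀ + G - T) Mᵀ M T').PosDef) : ∃ ε, 0 < ε ∧ BlockMargin ε G T M T' := by
  obtain ⟨s, hs, hle⟩ := h.exists_lower_bound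
  refine ⟨s, hs, fun u v => ?_⟩
  have huv := hle (Sum.elim u v)
  simp only [fromBlocks_mulVec, sumElim_dotProduct_sumElim, Sum.elim_comp_inl, Sum.elim_comp_inr,
    add_mulVec, sub_mulVec, dotProduct_add, dotProduct_sub] at huv
  have hG : u ⬝ᵥ Gᵀ *ᵥ u = u ⬝ᵥ G *ᵥ u := by
    rw [dotProduct_mulVec, vecMul_transpose, dotProduct_comm]
  have hM : u ⬝ᵥ Mᵀ *ᵥ v = v ⬝ᵥ M *ᵥ u := by
    rw [dotProduct_mulVec, vecMul_transpose, dotProduct_comm]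
  have hv : 0 ≤ v ⬝ᵥ v := Finset.sum_nonneg fun _ _ => mul_self_nonneg _
  rw [hG, hM] at huv
  nlinarith

theorem BlockMargin.isUnit {ε : ℝ} {G T M T' : Matrix (Fin n) (Fin n) ℝ} (hε : 0 < ε)
    (hT : T.PosSemidef) (h : BlockMargin ε G T M T') : IsUnit G := by
  rw [← mulVec_injective_iff_isUnit]
  refine (injective_iff_map_eq_zero G.mulVecLin).mpr fun u hu => ?_
  rw [mulVecLin_apply] at hu
  have h0 := h u 0
  have hT0 := hT.dotProduct_mulVec_nonneg u
  simp only [hu, dotProduct_zero, zero_dotProduct, star_trivial] at h0 hT0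
  have hnn : 0 ≤ u ⬝ᵥ u := Finset.sum_nonneg fun _ _ => mul_self_nonneg _
  exact dotProduct_self_eq_zero.mp (by nlinarith)

theorem BlockMargin.sum {κ : Type*} [Fintype κ] {ε : ℝ} {G : Matrix (Fin n) (Fin n) ℝ}
    {T M T' : κ → Matrix (Fin n) (Fin n) ℝ} {β : κ → ℝ} (hβ : ∀ k, 0 ≤ β k) (hβ1 : ∑ k, β k = 1)
    (h : ∀ k, BlockMargin ε G (T k) (M k) (T' k)) :
    BlockMargin ε G (∑ k, β k • T k) (∑ k, β k • M k) (∑ k, β k • T' k) := by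
  intro u v
  have key := Finset.sum_le_sum fun k (_ : k ∈ Finset.univ) =>
    mul_le_mul_of_nonneg_left (h k u v) (hβ k)
  simp only [mul_add, mul_sub, Finset.sum_add_distrib, Finset.sum_sub_distrib, ← Finset.sum_mul,
    hβ1, one_mul] at key
  simp only [sum_mulVec, dotProduct_sum, smul_mulVec, dotProduct_smul, smul_eq_mul,
    Finset.mul_sum]
  simpa only [mul_left_comm] using key

/-- The conjugate quadratic form of `T` at `x` is at most `r`; for positive definite `T` this
says `xᵀ T⁻¹ x ≤ r`. -/
def ConjLE (T : Matrix (Fin n) (Fin n) ℝ) (x : Fin n → ℝ) (r : ℝ) : Prop :=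
  ∀ v : Fin n → ℝ, 2 * (v ⬝ᵥ x) - v ⬝ᵥ T *ᵥ v ≤ r

theorem ConjLE.of_lower_bound {T : Matrix (Fin n) (Fin n) ℝ} {s : ℝ} (hs : 0 < s)
    (hT : ∀ z, s * (z ⬝ᵥ z) ≤ z ⬝ᵥ T *ᵥ z) (x : Fin n → ℝ) : ConjLE T x (s⁻¹ * (x ⬝ᵥ x)) := by
  intro v
  have h : 0 ≤ (s • v - x) ⬝ᵥ (s • v - x) := Finset.sum_nonneg fun _ _ => mul_self_nonneg _
  simp only [sub_dotProduct, dotProduct_sub, smul_dotProduct, dotProduct_smul, smul_eq_mul,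
    dotProduct_comm x v] at h
  have h2 := hT v
  rw [le_inv_mul_iff₀ hs]
  nlinarith

theorem ConjLE.dotProduct_self_le {T : Matrix (Fin n) (Fin n) ℝ} {b r : ℝ} (hb : 0 < b)
    (hT : ∀ z, z ⬝ᵥ T *ᵥ z ≤ b * (z ⬝ᵥ z)) {x : Fin n → ℝ} (h : ConjLE T x r) :
    x ⬝ᵥ x ≤ b * r := by
  have h1 := h (b⁻¹ • x)
  have h2 := hT (b⁻¹ • x)
  simp only [smul_dotProduct, dotProduct_smul, smul_eq_mul] at h1 h2
  have h3 : b⁻¹ * (x ⬝ᵥ x) ≤ r := by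
    have : b * (b⁻¹ * (b⁻¹ * (x ⬝ᵥ x))) = b⁻¹ * (x ⬝ᵥ x) := by field_simp
    linarith
  rwa [inv_mul_le_iff₀ hb] at h3

theorem ConjLE.step {ε b r : ℝ} {G T M T' : Matrix (Fin n) (Fin n) ℝ} (hε : 0 < ε) (hb : 0 < b)
    (hT : ∀ z, z ⬝ᵥ T *ᵥ z ≤ b * (z ⬝ᵥ z)) (hM : BlockMargin ε G T M T') {y : Fin n → ℝ}
    (h : ConjLE T (G *ᵥ y) r) : ConjLE T' (M *ᵥ y) ((1 + ε / b)⁻¹ * r) := by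
  intro v
  have hδ : 0 < 1 + ε / b := by positivity
  have h1 := hM y (-v)
  have h2 := h ((1 + ε / b) • y)
  have h3 : ε / b * (y ⬝ᵥ T *ᵥ y) ≤ ε * (y ⬝ᵥ y) := by
    have := mul_le_mul_of_nonneg_left (hT y) (div_pos hε hb).le
    rwa [← mul_assoc, div_mul_cancel₀ _ hb.ne'] at this
  simp only [smul_dotProduct, mulVec_smul, mulVec_neg, dotProduct_smul, smul_eq_mul,
    neg_dotProduct, dotProduct_neg, neg_neg] at h1 h2
  rw [le_inv_mul_iff₀ hδ]
  calc (1 + ε / b) * (2 * (v ⬝ᵥ M *ᵥ y) - v ⬝ᵥ T' *ᵥ v)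
      ≤ (1 + ε / b) * (2 * (y ⬝ᵥ G *ᵥ y) - (1 + ε / b) * (y ⬝ᵥ T *ᵥ y)) :=
        mul_le_mul_of_nonneg_left (by linarith) hδ.le
    _ ≤ r := by linarith

end QuadraticForms

theorem eNorm_eq_sqrt_dotProduct {n : ℕ} (x : Fin n → ℝ) : eNorm x = √(x ⬝ᵥ x) := by
  simp only [eNorm, dotProduct, sq]

/-- If a finite family of positive definite matrices is closed under successors for which the
block inequalities hold, the closed loop is uniformly exponentially stable. -/
theorem exponential_stability_of_successor {ι : Type*} [Fintype ι] {n m d : ℕ} (hd : 0 < d)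
    (Abar : Fin d → Matrix (Fin n) (Fin n) ℝ) (Bbar : Fin d → Matrix (Fin n) (Fin m) ℝ)
    (G : Matrix (Fin n) (Fin n) ℝ) (L : Matrix (Fin m) (Fin n) ℝ)
    (S : ι → Matrix (Fin n) (Fin n) ℝ) (hS : ∀ k, (S k).PosDef) (k₀ : ι)
    (hsucc : ∀ k i, ∃ k', (fromBlocks (Gᵀ + G - S k) (Abar i * G + Bbar i * L)ᵀ
        (Abar i * G + Bbar i * L) (S k')).PosDef) :
    IsUnit G ∧
    ∃ c : ℝ, 1 ≤ c ∧ ∃ lam : ℝ, lam ∈ Set.Ioo (0 : ℝ) 1 ∧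
      ∀ (α : ℕ → Fin d → ℝ), (∀ t i, 0 ≤ α t i) → (∀ t, ∑ i, α t i = 1) →
      ∀ x : ℕ → Fin n → ℝ,
        (∀ t, x (t + 1) =
          ((∑ i, α t i • Abar i) + (∑ i, α t i • Bbar i) * (L * G⁻¹)).mulVec (x t)) →
        ∀ t, eNorm (x t) ≤ c * lam ^ t * eNorm (x 0) := by
  classical
  have : Nonempty ι := ⟨k₀⟩
  have : Nonempty (Fin d) := ⟨⟨0, hd⟩⟩
  choose σ hσ using hsucc
  choose e he hmargin using fun ki : ι × Fin d => exists_blockMargin_of_posDef (hσ ki.1 ki.2)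
  obtain ⟨kmin, hkmin⟩ := Finite.exists_min e
  set ε := e kmin
  have hε : 0 < ε := he kmin
  have hblock : ∀ k i, BlockMargin ε G (S k) (Abar i * G + Bbar i * L) (S (σ k i)) :=
    fun k i => (hmargin (k, i)).mono (hkmin _)
  have hG : IsUnit G := (hblock k₀ ⟨0, hd⟩).isUnit hε (hS k₀).posSemidef
  refine ⟨hG, ?_⟩
  choose f hf hfS using fun k => (hS k).posSemidef.exists_upper_bound
  obtain ⟨kmax, hkmax⟩ := Finite.exists_max f
  set b := f kmax
  have hb : 0 < b := hf kmax
  obtain ⟨s, hs, hlow⟩ := (hS k₀).exists_lower_bound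
  set ρ := (1 + ε / b)⁻¹
  have hρ0 : 0 < ρ := by positivity
  have hρ1 : ρ < 1 := inv_lt_one_of_one_lt₀ (by linarith [div_pos hε hb])
  have hupper : ∀ β : ι → ℝ, (∀ k, 0 ≤ β k) → ∑ k, β k = 1 →
      ∀ z, z ⬝ᵥ (∑ k, β k • S k) *ᵥ z ≤ b * (z ⬝ᵥ z) := by
    intro β hβ hβ1 z
    have hz : 0 ≤ z ⬝ᵥ z := Finset.sum_nonneg fun _ _ => mul_self_nonneg _
    simp only [sum_mulVec, dotProduct_sum, smul_mulVec, dotProduct_smul, smul_eq_mul]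
    calc ∑ k, β k * (z ⬝ᵥ S k *ᵥ z) ≤ ∑ k, β k * (b * (z ⬝ᵥ z)) :=
          Finset.sum_le_sum fun k _ => mul_le_mul_of_nonneg_left
            ((hfS k z).trans (mul_le_mul_of_nonneg_right (hkmax k) hz)) (hβ k)
      _ = b * (z ⬝ᵥ z) := by rw [← Finset.sum_mul, hβ1, one_mul]
  refine ⟨max 1 √(b * s⁻¹), le_max_left _ _, √ρ,
    ⟨Real.sqrt_pos.mpr hρ0, (Real.sqrt_lt' one_pos).mpr (by simpa using hρ1)⟩, ?_⟩
  intro α hα hα1 x hx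
  have hinv : ∀ t, ∃ β : ι → ℝ, (∀ k, 0 ≤ β k) ∧ ∑ k, β k = 1 ∧
      ConjLE (∑ k, β k • S k) (x t) (ρ ^ t * (s⁻¹ * (x 0 ⬝ᵥ x 0))) := by
    intro t
    induction t with
    | zero =>
      refine ⟨Pi.single k₀ 1, fun k => ?_, by simp, ?_⟩
      · by_cases h : k = k₀ <;> simp [h]
      · simpa [Pi.single_apply] using ConjLE.of_lower_bound hs hlow (x 0)
    | succ t ih =>
      obtain ⟨β, hβ, hβ1, hle⟩ := ih
      have hw : ∑ ki : ι × Fin d, β ki.1 * α t ki.2 = 1 := by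
        simp [Fintype.sum_prod_type, ← Finset.mul_sum, hα1, hβ1]
      have hw0 : ∀ ki : ι × Fin d, 0 ≤ β ki.1 * α t ki.2 := fun ki => mul_nonneg (hβ _) (hα _ _)
      have hsum := BlockMargin.sum hw0 hw fun ki => hblock ki.1 ki.2
      have hT : ∑ ki : ι × Fin d, (β ki.1 * α t ki.2) • S ki.1 = ∑ k, β k • S k := by
        simp [Fintype.sum_prod_type, ← Finset.sum_smul, ← Finset.mul_sum, hα1]
      have hM : ∑ ki : ι × Fin d, (β ki.1 * α t ki.2) • (Abar ki.2 * G + Bbar ki.2 * L) =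
          (∑ i, α t i • Abar i) * G + (∑ i, α t i • Bbar i) * L := by
        rw [Fintype.sum_prod_type_right]
        simp [← Finset.sum_smul, ← Finset.sum_mul, hβ1, Finset.sum_add_distrib, Matrix.sum_mul]
      rw [hT, hM] at hsum
      have hdet := (isUnit_iff_isUnit_det G).mp hG
      have hxt : G *ᵥ (G⁻¹ *ᵥ x t) = x t := by
        rw [mulVec_mulVec, mul_nonsing_inv _ hdet, one_mulVec]
      rw [← hxt] at hle
      have hstep := ConjLE.step hε hb (hupper β hβ hβ1) hsum hle
      have hxs : ((∑ i, α t i • Abar i) * G + (∑ i, α t i • Bbar i) * L) *ᵥ (G⁻¹ *ᵥ x t) =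
          x (t + 1) := by
        rw [hx, mulVec_mulVec, add_mul, mul_assoc _ G, mul_nonsing_inv _ hdet, mul_one,
          Matrix.mul_assoc]
      refine ⟨fun k' => ∑ ki : ι × Fin d, if σ ki.1 ki.2 = k' then β ki.1 * α t ki.2 else 0,
        fun k' => Finset.sum_nonneg fun ki _ => ?_, ?_, ?_⟩
      · split_ifs
        exacts [hw0 ki, le_rfl]
      · rw [Finset.sum_comm]
        simpa using hw
      · have : ∑ k', (∑ ki : ι × Fin d, if σ ki.1 ki.2 = k' then β ki.1 * α t ki.2 else 0) • S k' =
            ∑ ki : ι × Fin d, (β ki.1 * α t ki.2) • S (σ ki.1 ki.2) := by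
          simp only [Finset.sum_smul, ite_smul, zero_smul]
          rw [Finset.sum_comm]
          simp
        rw [this, ← hxs, pow_succ', mul_assoc]
        exact hstep
  intro t
  obtain ⟨β, hβ, hβ1, hle⟩ := hinv t
  have hbound := hle.dotProduct_self_le hb (hupper β hβ hβ1)
  have hpow : √(ρ ^ t) = √ρ ^ t :=
    Real.sqrt_eq_iff_mul_self_eq (by positivity) (by positivity) |>.mpr <| by
      rw [← mul_pow, Real.mul_self_sqrt hρ0.le]
  rw [eNorm_eq_sqrt_dotProduct, eNorm_eq_sqrt_dotProduct]
  calc √(x t ⬝ᵥ x t) ≤ √(b * s⁻¹ * ρ ^ t * (x 0 ⬝ᵥ x 0)) :=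
        Real.sqrt_le_sqrt (hbound.trans_eq (by ring))
    _ = √(b * s⁻¹) * √ρ ^ t * √(x 0 ⬝ᵥ x 0) := by
        rw [Real.sqrt_mul (by positivity), Real.sqrt_mul (by positivity), hpow]
    _ ≤ _ := by gcongr; exact le_max_right _ _


theorem stmt_3 (n m d : ℕ) (hn : 0 < n) (hm : 0 < m) (hd : 0 < d)
    (Abar : Fin d → Matrix (Fin n) (Fin n) ℝ)
    (Bbar : Fin d → Matrix (Fin n) (Fin m) ℝ)
    (N : ℕ) (hN : 1 ≤ N)
    (G : Matrix (Fin n) (Fin n) ℝ) (L : Matrix (Fin m) (Fin n) ℝ)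
    (S : ∀ t : ℕ, (Fin t → Fin d) → Matrix (Fin n) (Fin n) ℝ)
    (hSpos : ∀ t, t < N → ∀ w : Fin t → Fin d, (S t w).PosDef)
    (h1 : ∀ t, t + 2 ≤ N → ∀ (w : Fin t → Fin d) (i : Fin d),
      (fromBlocks (Gᵀ + G - S t w) (Abar i * G + Bbar i * L)ᵀ
        (Abar i * G + Bbar i * L) (S (t + 1) (Fin.snoc w i))).PosDef)
    (h2 : ∀ (w : Fin (N - 1) → Fin d) (i : Fin d),
      (fromBlocks (Gᵀ + G - S (N - 1) w) (Abar i * G + Bbar i * L)ᵀ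
        (Abar i * G + Bbar i * L) (S 0 Fin.elim0)).PosDef) :
    IsUnit G ∧
    ∃ c : ℝ, 1 ≤ c ∧ ∃ lam : ℝ, lam ∈ Set.Ioo (0 : ℝ) 1 ∧
      ∀ (α : ℕ → Fin d → ℝ), (∀ t i, 0 ≤ α t i) → (∀ t, ∑ i, α t i = 1) →
      ∀ x : ℕ → Fin n → ℝ,
        (∀ t, x (t + 1) =
          ((∑ i, α t i • Abar i) + (∑ i, α t i • Bbar i) * (L * G⁻¹)).mulVec (x t)) →
        ∀ t, eNorm (x t) ≤ c * lam ^ t * eNorm (x 0) := by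
  refine exponential_stability_of_successor hd Abar Bbar G L
    (fun k : (t : Fin N) × (Fin t → Fin d) => S k.1 k.2) (fun k => hSpos k.1 k.1.2 k.2)
    ⟨⟨0, hN⟩, Fin.elim0⟩ ?_
  rintro ⟨⟨t, ht⟩, w⟩ i
  by_cases h : t + 2 ≤ N
  · exact ⟨⟨⟨t + 1, h⟩, Fin.snoc w i⟩, h1 t h w i⟩
  · obtain rfl : t = N - 1 := by omega
    exact ⟨⟨⟨0, hN⟩, Fin.elim0⟩, h2 w i⟩
end

section
/- Let N ≥ 1, let K^w ∈ ℝ^{m×n} be given for every word w of depth at most N−1, and let P₀ ∈ ℝ^{n×n} be symmetric positive definite. For a word w = (i₁,…,i_N) of depth N define the scenario product ψ^w = (Ā_{i_N} + B̄_{i_N} K^{(i₁,…,i_{N−1})}) ⋯ (Ā_{i₂} + B̄_{i₂} K^{(i₁)}) (Ā_{i₁} + B̄_{i₁} K^∅). Then the following are equivalent: (a) P₀ ≻ ψ^wᵀ P₀ ψ^w for every word w of depth N; (b) there exist symmetric positive definite matrices P^w ∈ ℝ^{n×n} for every word w of depth between 1 and N−1 such that, setting P^∅ = P₀, one has P^w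 ≻ (Ā_i + B̄_i K^w)ᵀ P^{w·i} (Ā_i + B̄_i K^w) for every word w of depth at most N−2 and every i ∈ {1,…,d}, and P^w ≻ (Ā_i + B̄_i K^w)ᵀ P₀ (Ā_i + B̄_i K^w) for every word w of depth exactly N−1 and every i ∈ {1,…,d}. -/
open Matrix

/-- The scenario product `ψ^w` along a word `w` of depth `t`: the product of the
closed-loop vertex matrices `Ā_{i_k} + B̄_{i_k} K^{(i₁,…,i_{k−1})}`, latest factor on the left. -/
noncomputable def scenProd {n m d : ℕ}
    (Abar : Fin d → Matrix (Fin n) (Fin n) ℝ)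
    (Bbar : Fin d → Matrix (Fin n) (Fin m) ℝ)
    (K : ∀ t : ℕ, (Fin t → Fin d) → Matrix (Fin m) (Fin n) ℝ) :
    ∀ t : ℕ, (Fin t → Fin d) → Matrix (Fin n) (Fin n) ℝ
  | 0, _ => 1
  | t + 1, w =>
      (Abar (w (Fin.last t)) + Bbar (w (Fin.last t)) * K t (Fin.init w)) *
        scenProd Abar Bbar K t (Fin.init w)

/-- The pull-forward of `S` along a word: at each step it is conjugated by the current transition
matrix `F t w i` and shifted by `ε • 1`, which keeps it positive definite for `ε > 0`. -/
noncomputable def scenGram {n d : ℕ}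
    (F : ∀ t : ℕ, (Fin t → Fin d) → Fin d → Matrix (Fin n) (Fin n) ℝ)
    (S : Matrix (Fin n) (Fin n) ℝ) (ε : ℝ) :
    ∀ t : ℕ, (Fin t → Fin d) → Matrix (Fin n) (Fin n) ℝ
  | 0, _ => S
  | t + 1, w =>
      F t (Fin.init w) (w (Fin.last t)) * scenGram F S ε t (Fin.init w) *
        (F t (Fin.init w) (w (Fin.last t)))ᵀ + ε • 1

section PosDef

variable {ι κ : Type*} [Fintype ι]

/-- Positive definiteness of one Schur complement passes to the other one. -/
theorem posDef_inv_sub_of_posDef_sub [Fintype κ] [DecidableEq ι] [DecidableEq κ]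
    {S : Matrix ι ι ℝ} {T : Matrix κ κ ℝ} {F : Matrix κ ι ℝ} (hS : S.PosDef)
    (hT : T.PosDef) (hD : (T - F * S * Fᵀ).PosDef) :
    (S⁻¹ - Fᵀ * T⁻¹ * F).PosDef := by
  set D := T - F * S * Fᵀ with hDdef
  have hFS : F * S * Fᵀ = T - D := by simp [hDdef]
  have hSS : S⁻¹ * S = 1 := nonsing_inv_mul _ ((isUnit_iff_isUnit_det _).1 hS.isUnit)
  have hTT : T⁻¹ * T = 1 := nonsing_inv_mul _ ((isUnit_iff_isUnit_det _).1 hT.isUnit)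
  have hDD : D * D⁻¹ = 1 := mul_nonsing_inv _ ((isUnit_iff_isUnit_det _).1 hD.isUnit)
  have hST : Sᵀ = S := by
    simpa [IsHermitian, conjTranspose_eq_transpose_of_trivial] using hS.isHermitian
  have hY : (S + S * Fᵀ * D⁻¹ * (F * S)).PosDef := by
    refine hS.add_posSemidef ?_
    have := hD.inv.posSemidef.conjTranspose_mul_mul_same (F * S)
    simpa only [conjTranspose_eq_transpose_of_trivial, transpose_mul, hST] using this
  have hmul : (S⁻¹ - Fᵀ * T⁻¹ * F) * (S + S * Fᵀ * D⁻¹ * (F * S)) = 1 := by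
    calc (S⁻¹ - Fᵀ * T⁻¹ * F) * (S + S * Fᵀ * D⁻¹ * (F * S))
        = S⁻¹ * S + (S⁻¹ * S) * Fᵀ * D⁻¹ * (F * S) - Fᵀ * T⁻¹ * (F * S)
            - Fᵀ * T⁻¹ * (F * S * Fᵀ) * D⁻¹ * (F * S) := by
          simp only [Matrix.sub_mul, Matrix.mul_add, Matrix.mul_assoc]; abel
      _ = 1 + Fᵀ * D⁻¹ * (F * S) - Fᵀ * T⁻¹ * (F * S)
            - (Fᵀ * (T⁻¹ * T) * D⁻¹ * (F * S) - Fᵀ * T⁻¹ * (D * D⁻¹) * (F * S)) := by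
          rw [hFS, hSS]; simp only [Matrix.sub_mul, Matrix.mul_sub, Matrix.mul_assoc, Matrix.one_mul]
      _ = 1 := by
          rw [hTT, hDD]; simp only [Matrix.mul_one]; abel
  rw [← inv_eq_left_inv hmul]
  exact hY.inv

/-- Positive definiteness persists along continuous families of symmetric matrices. -/
theorem eventually_posDef {X : Type*} [TopologicalSpace X] {f : X → Matrix ι ι ℝ} {a : X}
    (hf : Continuous f) (hsymm : ∀ x, (f x).IsHermitian) (ha : (f a).PosDef) :
    ∀ᶠ x in nhds a, (f x).PosDef := by
  have hcont : Continuous fun p : X × (ι → ℝ) => p.2 ⬝ᵥ (f p.1 *ᵥ p.2) := by fun_prop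
  have hsphere : ∀ᶠ x in nhds a, ∀ v ∈ Metric.sphere (0 : ι → ℝ) 1, 0 < v ⬝ᵥ (f x *ᵥ v) := by
    refine (isCompact_sphere (0 : ι → ℝ) 1).eventually_forall_of_forall_eventually fun v hv => ?_
    refine hcont.continuousAt.eventually (lt_mem_nhds ?_)
    have hv0 : v ≠ 0 := ne_zero_of_mem_unit_sphere ⟨v, hv⟩
    simpa using ha.dotProduct_mulVec_pos hv0
  filter_upwards [hsphere] with x hx
  refine PosDef.of_dotProduct_mulVec_pos (hsymm x) fun v hv => ?_
  have hn : 0 < ‖v‖ := norm_pos_iff.2 hv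
  have h := hx (‖v‖⁻¹ • v) (by simp [norm_smul, hn.ne'])
  simp only [mulVec_smul, smul_dotProduct, dotProduct_smul, smul_eq_mul] at h
  have hi : 0 < ‖v‖⁻¹ := inv_pos.2 hn
  simpa using (mul_pos_iff_of_pos_left hi).1 ((mul_pos_iff_of_pos_left hi).1 h)

end PosDef

section ScenGram

variable {n m d : ℕ} (F : ∀ t : ℕ, (Fin t → Fin d) → Fin d → Matrix (Fin n) (Fin n) ℝ)
  {S : Matrix (Fin n) (Fin n) ℝ}

theorem scenGram_snoc (S : Matrix (Fin n) (Fin n) ℝ) (ε : ℝ) {t : ℕ} (w : Fin t → Fin d)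
    (i : Fin d) :
    scenGram F S ε (t + 1) (Fin.snoc w i) = F t w i * scenGram F S ε t w * (F t w i)ᵀ + ε • 1 := by
  simp [scenGram]

theorem continuous_scenGram (S : Matrix (Fin n) (Fin n) ℝ) (t : ℕ) (w : Fin t → Fin d) :
    Continuous fun ε => scenGram F S ε t w := by
  induction t with
  | zero => exact continuous_const
  | succ t ih =>
    have := ih (Fin.init w)
    simp only [scenGram]
    fun_prop

theorem isHermitian_scenGram (hS : S.IsHermitian) (ε : ℝ) (t : ℕ) (w : Fin t → Fin d) :
    (scenGram F S ε t w).IsHermitian := by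
  induction t with
  | zero => exact hS
  | succ t ih =>
    have h := isHermitian_mul_mul_conjTranspose (F t (Fin.init w) (w (Fin.last t)))
      (ih (Fin.init w))
    rw [conjTranspose_eq_transpose_of_trivial] at h
    refine h.add ?_
    simp [IsHermitian]

theorem posDef_scenGram (hS : S.PosDef) {ε : ℝ} (hε : 0 < ε) (t : ℕ) (w : Fin t → Fin d) :
    (scenGram F S ε t w).PosDef := by
  induction t with
  | zero => exact hS
  | succ t ih =>
    have h := (ih (Fin.init w)).posSemidef.mul_mul_conjTranspose_same
      (F t (Fin.init w) (w (Fin.last t)))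
    rw [conjTranspose_eq_transpose_of_trivial] at h
    exact PosDef.posSemidef_add h (PosDef.one.smul hε)

theorem scenGram_zero_eq_scenProd (Abar : Fin d → Matrix (Fin n) (Fin n) ℝ)
    (Bbar : Fin d → Matrix (Fin n) (Fin m) ℝ)
    (K : ∀ t : ℕ, (Fin t → Fin d) → Matrix (Fin m) (Fin n) ℝ)
    (S : Matrix (Fin n) (Fin n) ℝ) (t : ℕ) (w : Fin t → Fin d) :
    scenGram (fun t w i => Abar i + Bbar i * K t w) S 0 t w =
      scenProd Abar Bbar K t w * S * (scenProd Abar Bbar K t w)ᵀ := by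
  induction t with
  | zero => simp [scenGram, scenProd]
  | succ t ih => simp [scenGram, scenProd, ih, Matrix.mul_assoc]

end ScenGram

/-- A sequence of tree-indexed matrices decreasing strictly along every edge dominates its
pull-back along the scenario products. -/
theorem posDef_sub_scenProd {n m d : ℕ}
    (Abar : Fin d → Matrix (Fin n) (Fin n) ℝ)
    (Bbar : Fin d → Matrix (Fin n) (Fin m) ℝ)
    (K : ∀ t : ℕ, (Fin t → Fin d) → Matrix (Fin m) (Fin n) ℝ)
    {P0 : Matrix (Fin n) (Fin n) ℝ}
    {Q : ∀ t : ℕ, (Fin t → Fin d) → Matrix (Fin n) (Fin n) ℝ} {N : ℕ}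
    (hQ0 : ∀ w, Q 0 w = P0)
    (hQ : ∀ t, t < N → ∀ (w : Fin t → Fin d) (i : Fin d),
      (Q t w - (Abar i + Bbar i * K t w)ᵀ * Q (t + 1) (Fin.snoc w i) *
        (Abar i + Bbar i * K t w)).PosDef) (t : ℕ) (ht : t < N) (w : Fin (t + 1) → Fin d) :
    (P0 - (scenProd Abar Bbar K (t + 1) w)ᵀ * Q (t + 1) w *
      scenProd Abar Bbar K (t + 1) w).PosDef := by
  induction t with
  | zero =>
    have h := hQ 0 ht (Fin.init w) (w (Fin.last 0))
    rw [Fin.snoc_init_self, hQ0] at h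
    simpa [scenProd] using h
  | succ t ih =>
    have h := hQ (t + 1) ht (Fin.init w) (w (Fin.last (t + 1)))
    rw [Fin.snoc_init_self] at h
    have hpull := h.posSemidef.conjTranspose_mul_mul_same
      (scenProd Abar Bbar K (t + 1) (Fin.init w))
    have hsum := (ih (by omega) (Fin.init w)).add_posSemidef hpull
    rw [conjTranspose_eq_transpose_of_trivial] at hsum
    rw [scenProd]
    convert hsum using 1
    simp only [transpose_mul, mul_sub, sub_mul, Matrix.mul_assoc]
    abel

theorem stmt_4 (n m d : ℕ) (hn : 0 < n) (hm : 0 < m) (hd : 0 < d)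
    (Abar : Fin d → Matrix (Fin n) (Fin n) ℝ)
    (Bbar : Fin d → Matrix (Fin n) (Fin m) ℝ)
    (N : ℕ) (hN : 1 ≤ N)
    (K : ∀ t : ℕ, (Fin t → Fin d) → Matrix (Fin m) (Fin n) ℝ)
    (P0 : Matrix (Fin n) (Fin n) ℝ) (hP0 : P0.PosDef) :
    (∀ w : Fin N → Fin d,
      (P0 - (scenProd Abar Bbar K N w)ᵀ * P0 * scenProd Abar Bbar K N w).PosDef) ↔
    (∃ P : ∀ t : ℕ, (Fin t → Fin d) → Matrix (Fin n) (Fin n) ℝ,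
      (∀ w : Fin 0 → Fin d, P 0 w = P0) ∧
      (∀ t, t < N → ∀ w : Fin t → Fin d, (P t w).PosDef) ∧
      (∀ t, t + 2 ≤ N → ∀ (w : Fin t → Fin d) (i : Fin d),
        (P t w - (Abar i + Bbar i * K t w)ᵀ * P (t + 1) (Fin.snoc w i) *
          (Abar i + Bbar i * K t w)).PosDef) ∧
      (∀ (w : Fin (N - 1) → Fin d) (i : Fin d),
        (P (N - 1) w - (Abar i + Bbar i * K (N - 1) w)ᵀ * P0 *
          (Abar i + Bbar i * K (N - 1) w)).PosDef)) := by
  obtain ⟨M, rfl⟩ : ∃ M, N = M + 1 := ⟨N - 1, by omega⟩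
  constructor
  · intro h
    set F : ∀ t : ℕ, (Fin t → Fin d) → Fin d → Matrix (Fin n) (Fin n) ℝ :=
      fun t w i => Abar i + Bbar i * K t w with hF
    have hev : ∀ᶠ ε in nhds (0 : ℝ), ∀ (w : Fin M → Fin d) (i : Fin d),
        (P0⁻¹ - F M w i * scenGram F P0⁻¹ ε M w * (F M w i)ᵀ).PosDef := by
      refine Filter.eventually_all.2 fun w => Filter.eventually_all.2 fun i => ?_
      refine eventually_posDef ?_ (fun ε => hP0.inv.isHermitian.sub ?_) ?_
      · have := continuous_scenGram F P0⁻¹ M w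
        fun_prop
      · rw [← conjTranspose_eq_transpose_of_trivial]
        exact isHermitian_mul_mul_conjTranspose _
          (isHermitian_scenGram F hP0.inv.isHermitian ε M w)
      · have hgram := scenGram_zero_eq_scenProd Abar Bbar K P0⁻¹ (M + 1) (Fin.snoc w i)
        rw [scenGram_snoc, zero_smul, add_zero] at hgram
        rw [hgram]
        have hw := h (Fin.snoc w i)
        simpa using posDef_inv_sub_of_posDef_sub (F := (scenProd Abar Bbar K (M + 1)
          (Fin.snoc w i))ᵀ) hP0 hP0 (by simpa using hw)
    obtain ⟨ε, hεw, hε⟩ :=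
      ((hev.filter_mono nhdsWithin_le_nhds).and (self_mem_nhdsWithin (s := Set.Ioi 0))).exists
    have hε : 0 < ε := hε
    have hpos := posDef_scenGram F hP0.inv hε
    refine ⟨fun t w => (scenGram F P0⁻¹ ε t w)⁻¹, fun w => ?_, fun t _ w => (hpos t w).inv,
      fun t _ w i => posDef_inv_sub_of_posDef_sub (hpos t w) (hpos _ _) ?_, fun w i => ?_⟩
    · exact nonsing_inv_nonsing_inv _ ((isUnit_iff_isUnit_det _).1 hP0.isUnit)
    · rw [scenGram_snoc]
      simpa [hF] using PosDef.one.smul hε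
    · have hlast := posDef_inv_sub_of_posDef_sub (hpos M w) hP0.inv (hεw w i)
      rwa [nonsing_inv_nonsing_inv _ ((isUnit_iff_isUnit_det _).1 hP0.isUnit)] at hlast
  · rintro ⟨P, hroot, -, hstep, hlast⟩ w
    have h := posDef_sub_scenProd Abar Bbar K (P0 := P0) (N := M + 1)
      (Q := fun t w => if t = M + 1 then P0 else P t w) (by simpa using hroot) ?_ M
      (Nat.lt_succ_self M) w
    · simpa using h
    · intro t ht v i
      rcases (Nat.lt_succ_iff.1 ht).eq_or_lt with rfl | htM
      · simpa using hlast v i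
      · simpa [ht.ne, htM.ne] using hstep t (by omega) v i
end

section
/- Let N ≥ 1. The following are equivalent: (a) there exist matrices L^w ∈ ℝ^{m×n} and symmetric positive definite matrices S^w ∈ ℝ^{n×n} for every word w of depth at most N−1 (write S₀ = S^∅) such that the 2n×2n block matrices [[S^w, (Ā_i S^w + B̄_i L^w)ᵀ], [Ā_i S^w + B̄_i L^w, S^{w·i}]] are positive definite for every word w of depth at most N−2 and every i ∈ {1,…,d}, and the block matrices [[S^w, (Ā_i S^w + B̄_i L^w)ᵀ], [Ā_i S^w + B̄_i L^w, S₀]] are positive definite for every word w of depth exactly N−1 and every i ∈ {1,…,d}; (b) there exist matrices K^w ∈ ℝ^{m×n} and symmetric positive definite matrices P^w ∈ ℝ^{n×n} for every word w of depth at most N−1 (write P₀ = P^∅) such that P^w ≻ (Ā_i + B̄_i K^w)ᵀ P^{w·i} (Ā_i + B̄_i K^w) for every word w of depth at most N−2 and every i ∈ {1,…,d}, and P^w ≻ (Ā_i + B̄_i K^w)ᵀ P₀ (Ā_i + B̄_i K^w) for every word w of depth exactly N−1 and every i ∈ {1,…,d}. Moreover, from (a) one obtains witnesses for (b) by setting P^w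 = (S^w)⁻¹ and K^w = L^w (S^w)⁻¹. -/
open Matrix

/-- The LMI conditions of the LITPC synthesis criterion (variables `L`, `S`). -/
def CondLMI {n m d : ℕ}
    (Abar : Fin d → Matrix (Fin n) (Fin n) ℝ)
    (Bbar : Fin d → Matrix (Fin n) (Fin m) ℝ) (N : ℕ)
    (L : ∀ t : ℕ, (Fin t → Fin d) → Matrix (Fin m) (Fin n) ℝ)
    (S : ∀ t : ℕ, (Fin t → Fin d) → Matrix (Fin n) (Fin n) ℝ) : Prop :=
  (∀ t, t < N → ∀ w : Fin t → Fin d, (S t w).PosDef) ∧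
  (∀ t, t + 2 ≤ N → ∀ (w : Fin t → Fin d) (i : Fin d),
    (fromBlocks (S t w) (Abar i * S t w + Bbar i * L t w)ᵀ
      (Abar i * S t w + Bbar i * L t w) (S (t + 1) (Fin.snoc w i))).PosDef) ∧
  (∀ (w : Fin (N - 1) → Fin d) (i : Fin d),
    (fromBlocks (S (N - 1) w) (Abar i * S (N - 1) w + Bbar i * L (N - 1) w)ᵀ
      (Abar i * S (N - 1) w + Bbar i * L (N - 1) w) (S 0 Fin.elim0)).PosDef)

/-- The Lyapunov-inequality conditions of the LITPC criterion (variables `K`, `P`). -/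
def CondLyap {n m d : ℕ}
    (Abar : Fin d → Matrix (Fin n) (Fin n) ℝ)
    (Bbar : Fin d → Matrix (Fin n) (Fin m) ℝ) (N : ℕ)
    (K : ∀ t : ℕ, (Fin t → Fin d) → Matrix (Fin m) (Fin n) ℝ)
    (P : ∀ t : ℕ, (Fin t → Fin d) → Matrix (Fin n) (Fin n) ℝ) : Prop :=
  (∀ t, t < N → ∀ w : Fin t → Fin d, (P t w).PosDef) ∧
  (∀ t, t + 2 ≤ N → ∀ (w : Fin t → Fin d) (i : Fin d),
    (P t w - (Abar i + Bbar i * K t w)ᵀ * P (t + 1) (Fin.snoc w i) *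
      (Abar i + Bbar i * K t w)).PosDef) ∧
  (∀ (w : Fin (N - 1) → Fin d) (i : Fin d),
    (P (N - 1) w - (Abar i + Bbar i * K (N - 1) w)ᵀ * P 0 Fin.elim0 *
      (Abar i + Bbar i * K (N - 1) w)).PosDef)

/-- Schur complement criterion for positive definiteness of a block matrix. -/
theorem Matrix.PosDef.fromBlocks_posDef_iff {k l : Type*} [Fintype k] [Fintype l]
    [DecidableEq k] [DecidableEq l] (A : Matrix k k ℝ) (B : Matrix k l ℝ) {D : Matrix l l ℝ}
    (hD : D.PosDef) :
    (fromBlocks A B Bᵀ D).PosDef ↔ (A - B * D⁻¹ * Bᵀ).PosDef := by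
  let : Invertible D := hD.isUnit.invertible
  have h := hD.fromBlocks₂₂ A B
  have hu := isUnit_fromBlocks_iff_of_invertible₂₂ (A := A) (B := B) (C := Bᵀ) (D := D)
  rw [conjTranspose_eq_transpose_of_trivial] at h
  rw [invOf_eq_nonsing_inv] at hu
  exact ⟨fun H => (h.1 H.posSemidef).posDef_iff_isUnit.2 (hu.1 H.isUnit),
    fun H => (h.2 H.posSemidef).posDef_iff_isUnit.2 (hu.2 H.isUnit)⟩

/-- The linearizing change of variables `P = S⁻¹`, `K = L * S⁻¹` turns the block matrix
inequality into the Lyapunov inequality of the closed loop. -/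
theorem posDef_fromBlocks_iff_lyapunov {n m : ℕ}
    (A : Matrix (Fin n) (Fin n) ℝ) (B : Matrix (Fin n) (Fin m) ℝ)
    (L : Matrix (Fin m) (Fin n) ℝ) {S T : Matrix (Fin n) (Fin n) ℝ}
    (hS : S.PosDef) (hT : T.PosDef) :
    (fromBlocks S (A * S + B * L)ᵀ (A * S + B * L) T).PosDef ↔
      (S⁻¹ - (A + B * (L * S⁻¹))ᵀ * T⁻¹ * (A + B * (L * S⁻¹))).PosDef := by
  have hdet : IsUnit S.det := (isUnit_iff_isUnit_det S).1 hS.isUnit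
  have hSt : Sᵀ = S := hS.isHermitian
  have hM : A * S + B * L = (A + B * (L * S⁻¹)) * S := by
    simp [add_mul, Matrix.mul_assoc, nonsing_inv_mul S hdet]
  have hschur := PosDef.fromBlocks_posDef_iff S (A * S + B * L)ᵀ hT
  rw [transpose_transpose] at hschur
  rw [hschur, hM, ← Matrix.IsUnit.posDef_star_left_conjugate_iff
    (x := S⁻¹ - (A + B * (L * S⁻¹))ᵀ * T⁻¹ * (A + B * (L * S⁻¹))) hS.isUnit,
    star_eq_conjTranspose, conjTranspose_eq_transpose_of_trivial, transpose_mul, hSt]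
  simp only [mul_sub, sub_mul, Matrix.mul_assoc, nonsing_inv_mul S hdet, mul_one]

theorem condLMI_iff_condLyap {n m d : ℕ}
    (Abar : Fin d → Matrix (Fin n) (Fin n) ℝ)
    (Bbar : Fin d → Matrix (Fin n) (Fin m) ℝ) {N : ℕ} (hN : 1 ≤ N)
    (L : ∀ t : ℕ, (Fin t → Fin d) → Matrix (Fin m) (Fin n) ℝ)
    (S : ∀ t : ℕ, (Fin t → Fin d) → Matrix (Fin n) (Fin n) ℝ)
    (hS : ∀ t, t < N → ∀ w : Fin t → Fin d, (S t w).PosDef) :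
    CondLMI Abar Bbar N L S ↔
      CondLyap Abar Bbar N (fun t w => L t w * (S t w)⁻¹) (fun t w => (S t w)⁻¹) := by
  refine and_congr (iff_of_true hS fun t ht w => (hS t ht w).inv) (and_congr ?_ ?_)
  · exact forall_congr' fun t => forall_congr' fun ht => forall_congr' fun w =>
      forall_congr' fun i => posDef_fromBlocks_iff_lyapunov _ _ _
        (hS t (by omega) w) (hS (t + 1) (by omega) _)
  · exact forall_congr' fun w => forall_congr' fun i => posDef_fromBlocks_iff_lyapunov _ _ _
      (hS (N - 1) (by omega) w) (hS 0 (by omega) _)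

/-- `CondLyap` only involves `K` and `P` at depths below `N`. -/
theorem CondLyap.congr {n m d : ℕ}
    {Abar : Fin d → Matrix (Fin n) (Fin n) ℝ}
    {Bbar : Fin d → Matrix (Fin n) (Fin m) ℝ} {N : ℕ} (hN : 1 ≤ N)
    {K K' : ∀ t : ℕ, (Fin t → Fin d) → Matrix (Fin m) (Fin n) ℝ}
    {P P' : ∀ t : ℕ, (Fin t → Fin d) → Matrix (Fin n) (Fin n) ℝ}
    (h : CondLyap Abar Bbar N K P) (hK : ∀ t, t < N → K' t = K t)
    (hP : ∀ t, t < N → P' t = P t) : CondLyap Abar Bbar N K' P' := by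
  obtain ⟨h₁, h₂, h₃⟩ := h
  refine ⟨fun t ht w => ?_, fun t ht w i => ?_, fun w i => ?_⟩
  · rw [hP t ht]
    exact h₁ t ht w
  · rw [hP t (by omega), hP (t + 1) (by omega), hK t (by omega)]
    exact h₂ t ht w i
  · rw [hP (N - 1) (by omega), hP 0 (by omega), hK (N - 1) (by omega)]
    exact h₃ w i

theorem stmt_5 (n m d : ℕ) (hn : 0 < n) (hm : 0 < m) (hd : 0 < d)
    (Abar : Fin d → Matrix (Fin n) (Fin n) ℝ)
    (Bbar : Fin d → Matrix (Fin n) (Fin m) ℝ)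
    (N : ℕ) (hN : 1 ≤ N) :
    ((∃ L S, CondLMI Abar Bbar N L S) ↔ (∃ K P, CondLyap Abar Bbar N K P)) ∧
    (∀ L S, CondLMI Abar Bbar N L S →
      CondLyap Abar Bbar N (fun t w => L t w * (S t w)⁻¹) (fun t w => (S t w)⁻¹)) := by
  have hfwd : ∀ L S, CondLMI Abar Bbar N L S →
      CondLyap Abar Bbar N (fun t w => L t w * (S t w)⁻¹) (fun t w => (S t w)⁻¹) :=
    fun L S h => (condLMI_iff_condLyap Abar Bbar hN L S h.1).1 h
  refine ⟨⟨fun ⟨L, S, h⟩ => ⟨_, _, hfwd L S h⟩, fun ⟨K, P, h⟩ => ?_⟩, hfwd⟩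
  refine ⟨fun t w => K t w * (P t w)⁻¹, fun t w => (P t w)⁻¹,
    (condLMI_iff_condLyap Abar Bbar hN _ _ fun t ht w => (h.1 t ht w).inv).2
      (h.congr hN (fun t ht => funext fun w => ?_) (fun t ht => funext fun w => ?_))⟩
  all_goals have hdet := (isUnit_iff_isUnit_det _).1 (h.1 t ht w).isUnit
  · simp [nonsing_inv_nonsing_inv _ hdet, Matrix.mul_assoc, nonsing_inv_mul _ hdet]
  · exact nonsing_inv_nonsing_inv _ hdet
end

section
/- Let N ≥ 1 and let D_0, …, D_{N−1} be nonempty compact sets of real n×n matrices. Call a sequence (x_t) in ℝⁿ admissible if for every m ∈ ℕ and every k ∈ {1,…,N} there exists Φ ∈ D_{k−1} with x_{mN+k} = Φ x_{mN}. Suppose there exists a symmetric positive definite matrix P₀ ∈ ℝ^{n×n} such that P₀ − Φᵀ P₀ Φ is positive definite for every Φ ∈ D_{N−1}. Then there exist c ≥ 1 and λ ∈ (0,1) such that every admissible sequence satisfies ‖x_t‖ ≤ c λ^t ‖x₀‖ for all t ∈ ℕ. -/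
open Matrix

theorem eNorm_nonneg {n : ℕ} (x : Fin n → ℝ) : 0 ≤ eNorm x := Real.sqrt_nonneg _

theorem eNorm_sq {n : ℕ} (x : Fin n → ℝ) : eNorm x ^ 2 = x ⬝ᵥ x := by
  rw [eNorm, Real.sq_sqrt (Finset.sum_nonneg fun i _ => sq_nonneg _)]
  simp [dotProduct, sq]

theorem eNorm_eq_zero {n : ℕ} {x : Fin n → ℝ} : eNorm x = 0 ↔ x = 0 := by
  rw [← sq_eq_zero_iff, eNorm_sq, dotProduct_self_eq_zero]

theorem isCompact_setOf_dotProduct_self_eq_one (n : ℕ) :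
    IsCompact {x : Fin n → ℝ | x ⬝ᵥ x = 1} := by
  refine Metric.isCompact_of_isClosed_isBounded
    (isClosed_eq (by fun_prop) continuous_const) ?_
  refine (Metric.isBounded_closedBall (x := (0 : Fin n → ℝ)) (r := 1)).subset fun x hx => ?_
  rw [mem_closedBall_zero_iff, pi_norm_le_iff_of_nonneg zero_le_one]
  intro i
  have h : x i * x i ≤ x ⬝ᵥ x :=
    Finset.single_le_sum (f := fun j => x j * x j) (fun j _ => mul_self_nonneg _)
      (Finset.mem_univ i)
  rw [show x ⬝ᵥ x = 1 from hx] at h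
  rw [Real.norm_eq_abs]
  exact abs_le_one_iff_mul_self_le_one.mpr h

theorem quadForm_eq_sq_mul_normalized {n : ℕ} (M : Matrix (Fin n) (Fin n) ℝ) {x : Fin n → ℝ}
    (hx : x ≠ 0) :
    ∃ u : Fin n → ℝ, u ⬝ᵥ u = 1 ∧ x ⬝ᵥ M *ᵥ x = (u ⬝ᵥ M *ᵥ u) * eNorm x ^ 2 := by
  have h0 : eNorm x ≠ 0 := fun h => hx (eNorm_eq_zero.mp h)
  refine ⟨(eNorm x)⁻¹ • x, ?_, ?_⟩
  · simp only [smul_dotProduct, dotProduct_smul, smul_eq_mul, ← eNorm_sq]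
    field_simp
  · simp only [smul_dotProduct, dotProduct_smul, mulVec_smul, smul_eq_mul]
    field_simp

/-- A compact set of positive definite matrices is uniformly positive definite. -/
theorem IsCompact.exists_forall_mul_sq_le_quadForm {n : ℕ} {K : Set (Matrix (Fin n) (Fin n) ℝ)}
    (hK : IsCompact K) (hpos : ∀ M ∈ K, M.PosDef) :
    ∃ a : ℝ, 0 < a ∧ ∀ M ∈ K, ∀ x : Fin n → ℝ, a * eNorm x ^ 2 ≤ x ⬝ᵥ M *ᵥ x := by
  have hS := hK.prod (isCompact_setOf_dotProduct_self_eq_one n)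
  have hcont : Continuous fun p : Matrix (Fin n) (Fin n) ℝ × (Fin n → ℝ) =>
      p.2 ⬝ᵥ p.1 *ᵥ p.2 := by fun_prop
  have key : ∃ a : ℝ, 0 < a ∧ ∀ p ∈ K ×ˢ {x : Fin n → ℝ | x ⬝ᵥ x = 1},
      a ≤ p.2 ⬝ᵥ p.1 *ᵥ p.2 := by
    obtain he | hne := (K ×ˢ {x : Fin n → ℝ | x ⬝ᵥ x = 1}).eq_empty_or_nonempty
    · exact ⟨1, one_pos, by simp [he]⟩
    · obtain ⟨p, hp, hmin⟩ := hS.exists_isMinOn hne hcont.continuousOn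
      refine ⟨_, ?_, hmin⟩
      have hp0 : p.2 ≠ 0 := by
        intro h
        have := hp.2
        simp [h] at this
      simpa using (hpos p.1 hp.1).dotProduct_mulVec_pos hp0
  obtain ⟨a, ha, h⟩ := key
  refine ⟨a, ha, fun M hM x => ?_⟩
  by_cases hx : x = 0
  · simp [hx, eNorm_eq_zero.mpr]
  obtain ⟨u, hu, hq⟩ := quadForm_eq_sq_mul_normalized M hx
  rw [hq]
  exact mul_le_mul_of_nonneg_right (h (M, u) ⟨hM, hu⟩) (sq_nonneg _)

theorem IsCompact.exists_forall_quadForm_le_mul_sq {n : ℕ} {K : Set (Matrix (Fin n) (Fin n) ℝ)}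
    (hK : IsCompact K) :
    ∃ b : ℝ, 0 < b ∧ ∀ M ∈ K, ∀ x : Fin n → ℝ, x ⬝ᵥ M *ᵥ x ≤ b * eNorm x ^ 2 := by
  have hS := hK.prod (isCompact_setOf_dotProduct_self_eq_one n)
  have hcont : Continuous fun p : Matrix (Fin n) (Fin n) ℝ × (Fin n → ℝ) =>
      p.2 ⬝ᵥ p.1 *ᵥ p.2 := by fun_prop
  obtain ⟨b, hb⟩ := hS.bddAbove_image hcont.continuousOn
  refine ⟨max b 1, by positivity, fun M hM x => ?_⟩
  by_cases hx : x = 0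
  · simp [hx, eNorm_eq_zero.mpr]
  obtain ⟨u, hu, hq⟩ := quadForm_eq_sq_mul_normalized M hx
  rw [hq]
  exact mul_le_mul_of_nonneg_right
    ((hb ⟨(M, u), ⟨hM, hu⟩, rfl⟩).trans (le_max_left _ _)) (sq_nonneg _)

theorem mulVec_quadForm {n : ℕ} (P Φ : Matrix (Fin n) (Fin n) ℝ) (x : Fin n → ℝ) :
    (Φ *ᵥ x) ⬝ᵥ P *ᵥ (Φ *ᵥ x) = x ⬝ᵥ (Φᵀ * P * Φ) *ᵥ x := by
  rw [← mulVec_mulVec, ← mulVec_mulVec, dotProduct_mulVec x, vecMul_transpose]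

theorem stmt_8 (n : ℕ) (hn : 0 < n) (N : ℕ) (hN : 1 ≤ N)
    (D : ℕ → Set (Matrix (Fin n) (Fin n) ℝ))
    (hne : ∀ k, k < N → (D k).Nonempty)
    (hcomp : ∀ k, k < N → IsCompact (D k))
    (P0 : Matrix (Fin n) (Fin n) ℝ) (hP0 : P0.PosDef)
    (hdec : ∀ Φ ∈ D (N - 1), (P0 - Φᵀ * P0 * Φ).PosDef) :
    ∃ c : ℝ, 1 ≤ c ∧ ∃ lam : ℝ, lam ∈ Set.Ioo (0 : ℝ) 1 ∧
      ∀ x : ℕ → Fin n → ℝ,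
        (∀ m k : ℕ, k < N → ∃ Φ ∈ D k, x (m * N + k + 1) = Φ.mulVec (x (m * N))) →
        ∀ t, eNorm (x t) ≤ c * lam ^ t * eNorm (x 0) := by
  obtain ⟨a, ha, hlow⟩ := (isCompact_singleton (x := P0)).exists_forall_mul_sq_le_quadForm
    (by simpa using hP0)
  obtain ⟨b, hb, hup⟩ := (isCompact_singleton (x := P0)).exists_forall_quadForm_le_mul_sq
  replace hlow := hlow P0 rfl
  replace hup := hup P0 rfl
  obtain ⟨d, hd, hdrop⟩ := ((hcomp (N - 1) (by omega)).image
    (f := fun Φ : Matrix (Fin n) (Fin n) ℝ => P0 - Φᵀ * P0 * Φ)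
    (by fun_prop)).exists_forall_mul_sq_le_quadForm
    (by rintro _ ⟨Φ, hΦ, rfl⟩; exact hdec Φ hΦ)
  have hU : IsCompact (⋃ k ∈ Set.Iio N, D k) :=
    (Set.finite_Iio N).isCompact_biUnion fun k hk => hcomp k hk
  obtain ⟨B, hB, hgrow⟩ := (hU.image
    (f := fun Φ : Matrix (Fin n) (Fin n) ℝ => Φᵀ * 1 * Φ)
    (by fun_prop)).exists_forall_quadForm_le_mul_sq
  obtain ⟨ρ, hρ0, hρ1, hρd⟩ : ∃ ρ : ℝ, 0 < ρ ∧ ρ < 1 ∧ 1 - d / b ≤ ρ :=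
    ⟨max (1 - d / b) (1 / 2), by positivity,
      max_lt (by linarith [div_pos hd hb]) (by norm_num), le_max_left _ _⟩
  have hN2 : 2 * N ≠ 0 := by omega
  obtain ⟨lam, hl0, hl1, hlρ⟩ : ∃ lam : ℝ, 0 < lam ∧ lam < 1 ∧ lam ^ (2 * N) = ρ :=
    ⟨ρ ^ (((2 * N : ℕ) : ℝ)⁻¹), Real.rpow_pos_of_pos hρ0 _,
      Real.rpow_lt_one hρ0.le hρ1 (by positivity), Real.rpow_inv_natCast_pow hρ0.le hN2⟩
  set C := B * (b / a) / ρ with hC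
  have hCpos : 0 < C := by positivity
  refine ⟨1 + C, by linarith, lam, ⟨hl0, hl1⟩, fun x hx t => ?_⟩
  have hV : ∀ m, x (m * N) ⬝ᵥ P0 *ᵥ x (m * N) ≤ ρ ^ m * (x 0 ⬝ᵥ P0 *ᵥ x 0) := by
    intro m
    induction m with
    | zero => simp
    | succ m ih =>
      obtain ⟨Φ, hΦ, he⟩ := hx m (N - 1) (by omega)
      have hidx : m * N + (N - 1) + 1 = (m + 1) * N := by rw [add_mul]; omega
      rw [hidx] at he
      have h1 := hdrop _ ⟨Φ, hΦ, rfl⟩ (x (m * N))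
      rw [sub_mulVec, dotProduct_sub, ← mulVec_quadForm, ← he] at h1
      have h2 := hup (x (m * N))
      have h3 := hlow (x (m * N))
      set v := x (m * N) ⬝ᵥ P0 *ᵥ x (m * N)
      have hv : 0 ≤ v := le_trans (by positivity) h3
      have h4 : d / b * v ≤ d * eNorm (x (m * N)) ^ 2 := by
        calc d / b * v ≤ d / b * (b * eNorm (x (m * N)) ^ 2) := by gcongr
          _ = _ := by field_simp
      calc _ ≤ (1 - d / b) * v := by linarith
        _ ≤ ρ * v := by gcongr
        _ ≤ ρ * (ρ ^ m * (x 0 ⬝ᵥ P0 *ᵥ x 0)) := by gcongr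
        _ = _ := by ring
  have hsample : ∀ m, eNorm (x (m * N)) ^ 2 ≤ b / a * ρ ^ m * eNorm (x 0) ^ 2 := by
    intro m
    have h1 : a * eNorm (x (m * N)) ^ 2 ≤ ρ ^ m * (b * eNorm (x 0) ^ 2) :=
      (hlow _).trans ((hV m).trans (by gcongr; exact hup _))
    calc eNorm (x (m * N)) ^ 2 = a * eNorm (x (m * N)) ^ 2 / a := by field_simp
      _ ≤ ρ ^ m * (b * eNorm (x 0) ^ 2) / a := by gcongr
      _ = _ := by ring
  cases t with
  | zero => nlinarith [eNorm_nonneg (x 0)]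
  | succ s =>
    have hk : s % N < N := Nat.mod_lt _ hN
    obtain ⟨Φ, hΦ, he⟩ := hx (s / N) (s % N) hk
    have hs : s / N * N + s % N = s := by rw [mul_comm]; exact Nat.div_add_mod s N
    rw [hs] at he
    have h1 := hgrow _ ⟨Φ, Set.mem_biUnion hk hΦ, rfl⟩ (x (s / N * N))
    rw [← mulVec_quadForm, ← he, one_mulVec, ← eNorm_sq] at h1
    have h2 : ρ ^ (s / N) * ρ ≤ lam ^ (2 * (s + 1)) := by
      rw [← pow_succ, ← hlρ, ← pow_mul]
      apply pow_le_pow_of_le_one hl0.le hl1.le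
      have : 2 * N * (s / N + 1) = 2 * (s / N * N) + 2 * N := by ring
      omega
    have hx0 := eNorm_nonneg (x 0)
    refine (sq_le_sq₀ (eNorm_nonneg _) (by positivity)).mp ?_
    calc eNorm (x (s + 1)) ^ 2
        ≤ B * (b / a * ρ ^ (s / N) * eNorm (x 0) ^ 2) := h1.trans (by gcongr; exact hsample _)
      _ = C * (ρ ^ (s / N) * ρ) * eNorm (x 0) ^ 2 := by rw [hC]; field_simp
      _ ≤ C * lam ^ (2 * (s + 1)) * eNorm (x 0) ^ 2 := by gcongr
      _ ≤ (1 + C) ^ 2 * lam ^ (2 * (s + 1)) * eNorm (x 0) ^ 2 := by gcongr; nlinarith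
      _ = _ := by ring
end

section
/- Let P₀ ∈ ℝ^{n×n} be symmetric positive definite, let s ≥ 1, and let M_1, …, M_s ∈ ℝ^{n×n} be symmetric positive semidefinite. Let A ∈ ℝ^{n×n} and suppose that P₀ − Aᵀ M_i A is positive definite for every i ∈ {1,…,s}. Then there exists a symmetric matrix Q ∈ ℝ^{n×n} such that Q − M_i is positive definite for every i ∈ {1,…,s} and P₀ − Aᵀ Q A is positive definite. -/
open Matrix

open Filter Topology in
/-- Positive definiteness is stable under small Hermitian perturbations. -/
theorem Matrix.PosDef.eventually_sub_smul {n : Type*} [Fintype n] {X Y : Matrix n n ℝ}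
    (hX : X.PosDef) (hY : Y.IsHermitian) : ∀ᶠ t : ℝ in 𝓝 0, (X - t • Y).PosDef := by
  have key : ∀ᶠ t : ℝ in 𝓝 0, ∀ x ∈ Metric.sphere (0 : n → ℝ) 1,
      0 < x ⬝ᵥ ((X - t • Y) *ᵥ x) := by
    refine (isCompact_sphere _ _).eventually_forall_of_forall_eventually fun x hx ↦ ?_
    have hc : Continuous fun z : ℝ × (n → ℝ) ↦ z.2 ⬝ᵥ ((X - z.1 • Y) *ᵥ z.2) := by fun_prop
    refine hc.continuousAt.eventually_const_lt ?_
    have hx0 : x ≠ 0 := ne_zero_of_mem_unit_sphere (⟨x, hx⟩ : Metric.sphere (0 : n → ℝ) 1)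
    simpa using hX.dotProduct_mulVec_pos hx0
  filter_upwards [key] with t ht
  refine .of_dotProduct_mulVec_pos (hX.1.sub (hY.smul (IsSelfAdjoint.all t))) fun x hx ↦ ?_
  have hn : 0 < ‖x‖ := norm_pos_iff.2 hx
  have h := ht (‖x‖⁻¹ • x) (by simp [norm_smul, hn.ne'])
  rw [mulVec_smul, smul_dotProduct, dotProduct_smul, smul_smul, smul_eq_mul] at h
  simpa using pos_of_mul_pos_right h (by positivity)

/-- The two Schur complements of a block matrix with positive definite diagonal blocks are
simultaneously positive definite. -/
theorem Matrix.PosDef.schur_swap {m n : Type*} [Fintype m] [Fintype n] [DecidableEq m]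
    [DecidableEq n] {P : Matrix m m ℝ} {S : Matrix n n ℝ} (hP : P.PosDef) (hS : S.PosDef)
    (A : Matrix n m ℝ) (h : (P - Aᵀ * S⁻¹ * A).PosDef) : (S - A * P⁻¹ * Aᵀ).PosDef := by
  refine .of_dotProduct_mulVec_pos (hS.1.sub ?_) fun y hy ↦ ?_
  · simpa using isHermitian_mul_mul_conjTranspose A hP.1.inv
  have hPu : IsUnit P.det := (isUnit_iff_isUnit_det P).1 hP.isUnit
  have hSu : IsUnit S.det := (isUnit_iff_isUnit_det S).1 hS.isUnit
  obtain ⟨x, hx⟩ : ∃ x, x = P⁻¹ *ᵥ (Aᵀ *ᵥ y) := ⟨_, rfl⟩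
  have hSpos : 0 < y ⬝ᵥ (S *ᵥ y) := by simpa using hS.dotProduct_mulVec_pos hy
  have hPx : P *ᵥ x = Aᵀ *ᵥ y := by rw [hx, mulVec_mulVec, mul_nonsing_inv _ hPu, one_mulVec]
  have hgoal : star y ⬝ᵥ ((S - A * P⁻¹ * Aᵀ) *ᵥ y) = y ⬝ᵥ (S *ᵥ y) - y ⬝ᵥ (A *ᵥ x) := by
    simp [sub_mulVec, dotProduct_sub, hx, mulVec_mulVec, Matrix.mul_assoc]
  rw [hgoal]
  by_cases hx0 : x = 0
  · simpa [hx0] using hSpos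
  have hxPx : x ⬝ᵥ (P *ᵥ x) = y ⬝ᵥ (A *ᵥ x) := by
    rw [hPx, dotProduct_mulVec, vecMul_transpose, dotProduct_comm]
  have h1 : 0 < x ⬝ᵥ (P *ᵥ x) - (A *ᵥ x) ⬝ᵥ (S⁻¹ *ᵥ (A *ᵥ x)) := by
    have := h.dotProduct_mulVec_pos hx0
    rwa [star_trivial, sub_mulVec, dotProduct_sub, ← mulVec_mulVec, ← mulVec_mulVec,
      dotProduct_mulVec x Aᵀ, vecMul_transpose] at this
  have h2 : 0 ≤ (S *ᵥ y - A *ᵥ x) ⬝ᵥ (S⁻¹ *ᵥ (S *ᵥ y - A *ᵥ x)) := by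
    simpa using hS.inv.posSemidef.dotProduct_mulVec_nonneg (S *ᵥ y - A *ᵥ x)
  have hST : Sᵀ = S := by simpa using hS.1.eq
  have h3 : (S *ᵥ y) ⬝ᵥ (S⁻¹ *ᵥ (A *ᵥ x)) = y ⬝ᵥ (A *ᵥ x) := by
    rw [← vecMul_transpose, hST, ← dotProduct_mulVec, mulVec_mulVec, mul_nonsing_inv _ hSu,
      one_mulVec]
  have h4 : S⁻¹ *ᵥ (S *ᵥ y) = y := by rw [mulVec_mulVec, nonsing_inv_mul _ hSu, one_mulVec]
  rw [mulVec_sub, h4, sub_dotProduct, dotProduct_sub, dotProduct_sub, h3,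
    dotProduct_comm (S *ᵥ y) y, dotProduct_comm (A *ᵥ x) y] at h2
  linarith

theorem stmt_11 (n s : ℕ) (hn : 0 < n) (hs : 1 ≤ s)
    (P0 : Matrix (Fin n) (Fin n) ℝ) (hP0 : P0.PosDef)
    (M : Fin s → Matrix (Fin n) (Fin n) ℝ) (hM : ∀ i, (M i).PosSemidef)
    (A : Matrix (Fin n) (Fin n) ℝ)
    (h : ∀ i, (P0 - Aᵀ * M i * A).PosDef) :
    ∃ Q : Matrix (Fin n) (Fin n) ℝ, Q.IsHermitian ∧
      (∀ i, (Q - M i).PosDef) ∧ (P0 - Aᵀ * Q * A).PosDef := by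
  have hAA : (Aᵀ * A).IsHermitian := by simpa using isHermitian_conjTranspose_mul_self A
  obtain ⟨δ, hδ, hδ0⟩ := ((Filter.eventually_all.2 fun i ↦
    ((h i).eventually_sub_smul hAA).filter_mono nhdsWithin_le_nhds).and
      (self_mem_nhdsWithin (s := Set.Ioi (0 : ℝ)))).exists
  have hδ1 : (δ • (1 : Matrix (Fin n) (Fin n) ℝ)).PosDef := Matrix.PosDef.one.smul hδ0
  have hN (i) : (M i + δ • 1).PosDef := .posSemidef_add (hM i) hδ1
  have hNu (i) : (M i + δ • 1)⁻¹⁻¹ = M i + δ • 1 :=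
    nonsing_inv_nonsing_inv _ ((isUnit_iff_isUnit_det _).1 (hN i).isUnit)
  have hS (i) : ((M i + δ • 1)⁻¹ - A * P0⁻¹ * Aᵀ).PosDef := by
    refine hP0.schur_swap (hN i).inv A ?_
    have := hδ i
    rw [hNu]
    convert this using 1
    simp [mul_add, add_mul, sub_sub]
  obtain ⟨ε, hε, hε0⟩ := ((Filter.eventually_all.2 fun i ↦
    ((hS i).eventually_sub_smul isHermitian_one).filter_mono nhdsWithin_le_nhds).and
      (self_mem_nhdsWithin (s := Set.Ioi (0 : ℝ)))).exists
  have hε1 : (ε • (1 : Matrix (Fin n) (Fin n) ℝ)).PosDef := Matrix.PosDef.one.smul hε0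
  have hW : (A * P0⁻¹ * Aᵀ + ε • 1).PosDef :=
    .posSemidef_add (by simpa using hP0.inv.posSemidef.mul_mul_conjTranspose_same A) hε1
  have hWu := nonsing_inv_nonsing_inv _ ((isUnit_iff_isUnit_det _).1 hW.isUnit)
  refine ⟨(A * P0⁻¹ * Aᵀ + ε • 1)⁻¹, hW.inv.1, fun i ↦ ?_, ?_⟩
  · have := (hN i).inv.schur_swap hW.inv 1 (by
      rw [hWu]; simpa [sub_sub] using hε i)
    rw [hNu] at this
    convert this.add hδ1 using 1
    simp only [Matrix.one_mul, transpose_one, Matrix.mul_one]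
    abel
  · simpa using hW.schur_swap hP0 Aᵀ (by simpa using hε1)
end

section
/- Let N ≥ 1 and suppose there exist matrices L^w ∈ ℝ^{m×n} and symmetric positive definite matrices S^w ∈ ℝ^{n×n} for every word w of depth at most N−1 (write S₀ = S^∅) such that the 2n×2n block matrices [[S^w, (Ā_i S^w + B̄_i L^w)ᵀ], [Ā_i S^w + B̄_i L^w, S^{w·i}]] are positive definite for every word w of depth at most N−2 and every i ∈ {1,…,d}, and the block matrices [[S^w, (Ā_i S^w + B̄_i L^w)ᵀ], [Ā_i S^w + B̄_i L^w, S₀]] are positive definite for every word w of depth exactly N−1 and every i ∈ {1,…,d}. Set K^w = L^w (S^w)⁻¹. Consider the linear interpolating tree periodic closed loop: for any x₀ ∈ ℝⁿ and any admissible uncertainty sequence (α_t), for each m ∈ ℕ set s = mN and define tree states y^∅ = x_s and y^{w·i} = (Ā_i + B̄_i K^w) y^w for words w of depth at most N−1, weights β^∅ = 1 and β^{w·i} = α_{s+|w|, i} β^w, and for k = 0,…,N−1 let x_{s+k+1} = A_{s+k} x_{s+k} + B_{s+k} u_{s+k} with u_{s+k} = Σ_{|w|=k} β^w K^w y^w.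 Then there exist c ≥ 1 and λ ∈ (0,1) such that ‖x_t‖ ≤ c λ^t ‖x₀‖ for all t ∈ ℕ, for every x₀ and every admissible uncertainty sequence. -/
open Matrix

/-- The quadratic form `x ↦ x ⬝ᵥ P x` of a matrix. -/
def quadForm {n : ℕ} (P : Matrix (Fin n) (Fin n) ℝ) (x : Fin n → ℝ) : ℝ := x ⬝ᵥ P *ᵥ x

lemma quadForm_smul {n : ℕ} (P : Matrix (Fin n) (Fin n) ℝ) (c : ℝ) (x : Fin n → ℝ) :
    quadForm P (c • x) = c ^ 2 * quadForm P x := by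
  simp only [quadForm, mulVec_smul, dotProduct_smul, smul_dotProduct, smul_eq_mul]
  ring

lemma quadForm_pos {n : ℕ} {P : Matrix (Fin n) (Fin n) ℝ} (hP : P.PosDef)
    {x : Fin n → ℝ} (hx : x ≠ 0) : 0 < quadForm P x := by
  simpa [quadForm] using hP.dotProduct_mulVec_pos hx

lemma quadForm_nonneg {n : ℕ} {P : Matrix (Fin n) (Fin n) ℝ} (hP : P.PosDef)
    (x : Fin n → ℝ) : 0 ≤ quadForm P x := by
  rcases eq_or_ne x 0 with rfl | hx
  · simp [quadForm]
  · exact (quadForm_pos hP hx).le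

lemma continuous_quadForm {n : ℕ} (P : Matrix (Fin n) (Fin n) ℝ) :
    Continuous (quadForm P) := by
  unfold quadForm
  fun_prop

lemma convexOn_quadForm {n : ℕ} {P : Matrix (Fin n) (Fin n) ℝ} (hP : P.PosDef) :
    ConvexOn ℝ Set.univ (quadForm P) := by
  refine ⟨convex_univ, fun x _ y _ a b ha hb hab => ?_⟩
  have key : a • quadForm P x + b • quadForm P y - quadForm P (a • x + b • y)
      = a * b * quadForm P (x - y) := by
    obtain rfl : b = 1 - a := by linarith
    simp only [quadForm, mulVec_add, mulVec_sub, mulVec_smul, dotProduct_add, add_dotProduct,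
      dotProduct_sub, sub_dotProduct, dotProduct_smul, smul_dotProduct, smul_eq_mul]
    ring
  have := mul_nonneg (mul_nonneg ha hb) (quadForm_nonneg hP (x - y))
  linarith

lemma eNorm_eq {n : ℕ} (x : Fin n → ℝ) : eNorm x = Real.sqrt (quadForm 1 x) := by
  simp [eNorm, quadForm, dotProduct, sq]

/-- Two continuous functions that are homogeneous of degree two are comparable as soon as the
second is positive away from the origin. -/
lemma exists_le_mul_of_homogeneous {n : ℕ} {f g : (Fin n → ℝ) → ℝ} (hf : Continuous f)
    (hg : Continuous g) (hf2 : ∀ (c : ℝ) x, f (c • x) = c ^ 2 * f x)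
    (hg2 : ∀ (c : ℝ) x, g (c • x) = c ^ 2 * g x) (hpos : ∀ x, x ≠ 0 → 0 < g x) :
    ∃ C : ℝ, ∀ x, f x ≤ C * g x := by
  have hne : ∀ x ∈ Metric.sphere (0 : Fin n → ℝ) 1, g x ≠ 0 := fun x hx =>
    (hpos x (by rintro rfl; simp at hx)).ne'
  obtain ⟨C, hC⟩ := (isCompact_sphere (0 : Fin n → ℝ) 1).exists_bound_of_continuousOn
    (hf.continuousOn.div hg.continuousOn hne)
  refine ⟨C, fun x => ?_⟩
  rcases eq_or_ne x 0 with rfl | hx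
  · have h1 := hf2 0 0
    have h2 := hg2 0 0
    simp at h1 h2
    simp [h1, h2]
  · have hx' : (‖x‖⁻¹ • x) ∈ Metric.sphere (0 : Fin n → ℝ) 1 := by
      simp [norm_smul, hx]
    have h := (Real.le_norm_self _).trans (hC _ hx')
    rw [Pi.div_apply, hf2, hg2, mul_div_mul_left _ _ (by simp [hx]), div_le_iff₀ (hpos x hx)] at h
    exact h

lemma exists_quadForm_le {n : ℕ} {ι : Type*} [Finite ι] (P Q : ι → Matrix (Fin n) (Fin n) ℝ)
    (hQ : ∀ i, (Q i).PosDef) :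
    ∃ C : ℝ, ∀ i x, quadForm (P i) x ≤ C * quadForm (Q i) x := by
  choose C hC using fun i => exists_le_mul_of_homogeneous (continuous_quadForm (P i))
    (continuous_quadForm (Q i)) (quadForm_smul _) (quadForm_smul _) (fun _ => quadForm_pos (hQ i))
  obtain ⟨M, hM⟩ := Finite.exists_le C
  exact ⟨M, fun i x => (hC i x).trans
    (mul_le_mul_of_nonneg_right (hM i) (quadForm_nonneg (hQ i) x))⟩

/-- Positive definiteness of the block matrix makes the quadratic form strictly decrease along
the closed loop. -/
lemma quadForm_closedLoop_lt {n m : ℕ} {S S' : Matrix (Fin n) (Fin n) ℝ}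
    {A : Matrix (Fin n) (Fin n) ℝ} {B : Matrix (Fin n) (Fin m) ℝ} {L : Matrix (Fin m) (Fin n) ℝ}
    (hS : S.PosDef) (hS' : S'.PosDef)
    (h : (fromBlocks S (A * S + B * L)ᵀ (A * S + B * L) S').PosDef)
    {y : Fin n → ℝ} (hy : y ≠ 0) :
    quadForm S'⁻¹ ((A + B * (L * S⁻¹)) *ᵥ y) < quadForm S⁻¹ y := by
  have hSS : S * S⁻¹ = 1 := mul_nonsing_inv _ ((isUnit_iff_isUnit_det _).1 hS.isUnit)
  have hSS' : S' * S'⁻¹ = 1 := mul_nonsing_inv _ ((isUnit_iff_isUnit_det _).1 hS'.isUnit)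
  obtain ⟨u, hu⟩ : ∃ u, u = (A + B * (L * S⁻¹)) *ᵥ y := ⟨_, rfl⟩
  obtain ⟨z, hz⟩ : ∃ z, z = S⁻¹ *ᵥ y := ⟨_, rfl⟩
  have hSz : S *ᵥ z = y := by rw [hz, mulVec_mulVec, hSS, one_mulVec]
  have hMz : (A * S + B * L) *ᵥ z = u := by
    rw [hz, hu, mulVec_mulVec, Matrix.add_mul, Matrix.mul_assoc, hSS, Matrix.mul_one,
      Matrix.mul_assoc]
  have hz0 : z ≠ 0 := by
    intro h0
    rw [h0, mulVec_zero] at hSz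
    exact hy hSz.symm
  have hne : Sum.elim z (-(S'⁻¹ *ᵥ u)) ≠ 0 := fun h0 =>
    hz0 (funext fun i => congrFun h0 (Sum.inl i))
  have hpos := h.dotProduct_mulVec_pos hne
  have hT : z ⬝ᵥ (A * S + B * L)ᵀ *ᵥ (S'⁻¹ *ᵥ u) = u ⬝ᵥ (S'⁻¹ *ᵥ u) := by
    rw [dotProduct_mulVec, vecMul_transpose, hMz]
  rw [star_trivial, fromBlocks_mulVec, sumElim_dotProduct_sumElim] at hpos
  simp only [Sum.elim_comp_inl, Sum.elim_comp_inr, hSz, hMz, mulVec_neg, dotProduct_add,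
    dotProduct_neg, neg_dotProduct, hT] at hpos
  rw [mulVec_mulVec, hSS', one_mulVec] at hpos
  rw [← hu, quadForm, quadForm, ← hz, dotProduct_comm y z]
  linarith

lemma exists_quadForm_closedLoop_le {n m : ℕ} {ι : Type*} [Finite ι]
    {S S' : ι → Matrix (Fin n) (Fin n) ℝ} {A : ι → Matrix (Fin n) (Fin n) ℝ}
    {B : ι → Matrix (Fin n) (Fin m) ℝ} {L : ι → Matrix (Fin m) (Fin n) ℝ}
    (hS : ∀ i, (S i).PosDef) (hS' : ∀ i, (S' i).PosDef)
    (h : ∀ i, (fromBlocks (S i) (A i * S i + B i * L i)ᵀ (A i * S i + B i * L i) (S' i)).PosDef) :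
    ∃ ρ ∈ Set.Ioo (0 : ℝ) 1, ∀ i y,
      quadForm (S' i)⁻¹ ((A i + B i * (L i * (S i)⁻¹)) *ᵥ y) ≤ ρ * quadForm (S i)⁻¹ y := by
  set g : ι → (Fin n → ℝ) → ℝ := fun i y =>
    quadForm (S i)⁻¹ y - quadForm (S' i)⁻¹ ((A i + B i * (L i * (S i)⁻¹)) *ᵥ y) with hg
  have hgpos : ∀ i y, y ≠ 0 → 0 < g i y := fun i y hy =>
    sub_pos.2 (quadForm_closedLoop_lt (hS i) (hS' i) (h i) hy)
  have hg0 : ∀ i y, 0 ≤ g i y := by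
    intro i y
    rcases eq_or_ne y 0 with rfl | hy
    · simp [hg, quadForm]
    · exact (hgpos i y hy).le
  choose C hC using fun i => exists_le_mul_of_homogeneous (continuous_quadForm (S i)⁻¹)
    (g := g i)
    ((continuous_quadForm _).sub ((continuous_quadForm _).comp (by fun_prop)))
    (quadForm_smul _)
    (fun c x => by simp only [hg, mulVec_smul, quadForm_smul]; ring) (hgpos i)
  obtain ⟨M, hM⟩ := Finite.exists_le C
  set K := max M 2 with hK
  have hK2 : 2 ≤ K := le_max_right _ _
  have hK0 : 0 < K := by linarith
  refine ⟨1 - K⁻¹, ⟨?_, ?_⟩, fun i y => ?_⟩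
  · have : K⁻¹ ≤ 2⁻¹ := by gcongr
    linarith
  · have := inv_pos.2 hK0
    linarith
  · have h1 : quadForm (S i)⁻¹ y ≤ K * g i y := (hC i y).trans
      (mul_le_mul_of_nonneg_right ((hM i).trans (le_max_left _ _)) (hg0 i y))
    have h2 : K⁻¹ * quadForm (S i)⁻¹ y ≤ g i y := by
      rwa [inv_mul_le_iff₀ hK0]
    simp only [hg] at h2
    linarith

lemma sum_words_succ {d k : ℕ} {M : Type*} [AddCommMonoid M] (f : (Fin (k + 1) → Fin d) → M) :
    ∑ w, f w = ∑ w : Fin k → Fin d, ∑ i, f (Fin.snoc w i) := by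
  rw [← (Fin.snocEquiv fun _ : Fin (k + 1) => Fin d).sum_comp f, Fintype.sum_prod_type_right]
  rfl

theorem stmt_13 (n m d : ℕ) (hn : 0 < n) (hm : 0 < m) (hd : 0 < d)
    (Abar : Fin d → Matrix (Fin n) (Fin n) ℝ)
    (Bbar : Fin d → Matrix (Fin n) (Fin m) ℝ)
    (N : ℕ) (hN : 1 ≤ N)
    (L : ∀ t : ℕ, (Fin t → Fin d) → Matrix (Fin m) (Fin n) ℝ)
    (S : ∀ t : ℕ, (Fin t → Fin d) → Matrix (Fin n) (Fin n) ℝ)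
    (hSpos : ∀ t, t < N → ∀ w : Fin t → Fin d, (S t w).PosDef)
    (h1 : ∀ t, t + 2 ≤ N → ∀ (w : Fin t → Fin d) (i : Fin d),
      (fromBlocks (S t w) (Abar i * S t w + Bbar i * L t w)ᵀ
        (Abar i * S t w + Bbar i * L t w) (S (t + 1) (Fin.snoc w i))).PosDef)
    (h2 : ∀ (w : Fin (N - 1) → Fin d) (i : Fin d),
      (fromBlocks (S (N - 1) w) (Abar i * S (N - 1) w + Bbar i * L (N - 1) w)ᵀ
        (Abar i * S (N - 1) w + Bbar i * L (N - 1) w) (S 0 Fin.elim0)).PosDef) :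
    -- the gains are `K t w = L t w * (S t w)⁻¹`
    ∃ c : ℝ, 1 ≤ c ∧ ∃ lam : ℝ, lam ∈ Set.Ioo (0 : ℝ) 1 ∧
      ∀ (α : ℕ → Fin d → ℝ), (∀ t i, 0 ≤ α t i) → (∀ t, ∑ i, α t i = 1) →
      ∀ (x : ℕ → Fin n → ℝ)
        (y : ℕ → ∀ t : ℕ, (Fin t → Fin d) → Fin n → ℝ)
        (β : ℕ → ∀ t : ℕ, (Fin t → Fin d) → ℝ),
        -- tree states simulated at the beginning of each period `p`
        (∀ (p : ℕ) (w : Fin 0 → Fin d), y p 0 w = x (p * N)) →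
        (∀ (p t : ℕ), t < N → ∀ (w : Fin t → Fin d) (i : Fin d),
          y p (t + 1) (Fin.snoc w i) =
            (Abar i + Bbar i * (L t w * (S t w)⁻¹)).mulVec (y p t w)) →
        -- interpolation weights
        (∀ (p : ℕ) (w : Fin 0 → Fin d), β p 0 w = 1) →
        (∀ (p t : ℕ) (w : Fin t → Fin d) (i : Fin d),
          β p (t + 1) (Fin.snoc w i) = α (p * N + t) i * β p t w) →
        -- closed-loop plant with the interpolating tree periodic inputs
        (∀ (p k : ℕ), k < N →
          x (p * N + k + 1) =
            (∑ i, α (p * N + k) i • Abar i).mulVec (x (p * N + k)) +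
            (∑ i, α (p * N + k) i • Bbar i).mulVec
              (∑ w : Fin k → Fin d, β p k w • (L k w * (S k w)⁻¹).mulVec (y p k w))) →
        ∀ t, eNorm (x t) ≤ c * lam ^ t * eNorm (x 0) := by
  classical
  obtain ⟨T, hT, hTN⟩ : ∃ T : ∀ t : ℕ, (Fin t → Fin d) → Matrix (Fin n) (Fin n) ℝ,
      (∀ t < N, ∀ w, T t w = S t w) ∧ ∀ w, T N w = S 0 Fin.elim0 :=
    ⟨fun t w => if t < N then S t w else S 0 Fin.elim0, fun t ht w => if_pos ht,
      fun w => if_neg (lt_irrefl N)⟩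
  have hTpos : ∀ t ≤ N, ∀ w, (T t w).PosDef := by
    intro t ht w
    rcases ht.lt_or_eq with h | rfl
    · exact hT t h w ▸ hSpos t h w
    · exact hTN w ▸ hSpos 0 (by omega) _
  have hblock : ∀ t < N, ∀ (w : Fin t → Fin d) (i : Fin d),
      (fromBlocks (S t w) (Abar i * S t w + Bbar i * L t w)ᵀ
        (Abar i * S t w + Bbar i * L t w) (T (t + 1) (Fin.snoc w i))).PosDef := by
    intro t ht w i
    rcases Nat.lt_or_ge (t + 1) N with h | h
    · rw [hT _ h]
      exact h1 t h w i
    · obtain rfl : N = t + 1 := by omega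
      rw [hTN]
      exact h2 w i
  obtain ⟨ρ, ⟨hρ0, hρ1⟩, hρ⟩ := exists_quadForm_closedLoop_le
    (ι := Σ t : Fin N, (Fin t → Fin d) × Fin d)
    (S := fun j => S j.1 j.2.1) (S' := fun j => T (j.1 + 1) (Fin.snoc j.2.1 j.2.2))
    (A := fun j => Abar j.2.2) (B := fun j => Bbar j.2.2) (L := fun j => L j.1 j.2.1)
    (fun j => hSpos _ j.1.2 _) (fun j => hTpos _ j.1.2 _) (fun j => hblock _ j.1.2 _ _)
  obtain ⟨a, ha⟩ := exists_quadForm_le (ι := Σ t : Fin (N + 1), (Fin t → Fin d))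
    (fun _ => 1) (fun j => (T j.1 j.2)⁻¹)
    (fun j => (hTpos _ (Nat.le_of_lt_succ j.1.2) _).inv)
  obtain ⟨b, hb⟩ := exists_quadForm_le (ι := Unit)
    (fun _ => (S 0 Fin.elim0)⁻¹) (fun _ => 1) (fun _ => PosDef.one)
  set P := (S 0 Fin.elim0)⁻¹ with hP
  have hPpos : P.PosDef := (hSpos 0 (by omega) _).inv
  set C := max 1 (max 0 a * max 0 b) with hC
  refine ⟨Real.sqrt C, by simp [hC], Real.sqrt ρ,
    ⟨Real.sqrt_pos.2 hρ0, by rw [Real.sqrt_lt' one_pos]; simpa using hρ1⟩, ?_⟩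
  intro α hα0 hα1 x y β hy0 hy hβ0 hβ hx
  have hβnn : ∀ p t w, 0 ≤ β p t w := by
    intro p t
    induction t with
    | zero => intro w; simp [hβ0]
    | succ t ih =>
      intro w
      rw [← Fin.snoc_init_self w, hβ]
      exact mul_nonneg (hα0 _ _) (ih _)
  have hβsum : ∀ p t, ∑ w, β p t w = 1 := by
    intro p t
    induction t with
    | zero => simp [hβ0]
    | succ t ih => simp only [sum_words_succ, hβ, ← Finset.sum_mul, hα1, one_mul, ih]
  have hinterp : ∀ p t, t ≤ N → x (p * N + t) = ∑ w, β p t w • y p t w := by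
    intro p t
    induction t with
    | zero => intro _; simp [hβ0, hy0]
    | succ t ih =>
      intro ht
      rw [← add_assoc, hx p t ht, ih (by omega), sum_words_succ, mulVec_sum, mulVec_sum,
        ← Finset.sum_add_distrib]
      refine Finset.sum_congr rfl fun w _ => ?_
      simp only [hβ, hy p t ht, sum_mulVec]
      rw [← Finset.sum_add_distrib]
      refine Finset.sum_congr rfl fun i _ => ?_
      rw [add_mulVec, smul_mulVec, smul_mulVec, mulVec_smul, mulVec_smul, smul_smul, smul_smul,
        smul_add, mulVec_mulVec]
  have hdecay : ∀ p t, t ≤ N → ∀ w, quadForm (T t w)⁻¹ (y p t w) ≤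
      ρ ^ t * quadForm P (x (p * N)) := by
    intro p t
    induction t with
    | zero =>
      intro _ w
      rw [hT 0 (by omega), hy0, Subsingleton.elim w Fin.elim0]
      simp [hP]
    | succ t ih =>
      intro ht w
      rw [← Fin.snoc_init_self w, hy p t ht]
      refine (hρ ⟨⟨t, ht⟩, Fin.init w, w (Fin.last t)⟩ _).trans ?_
      have := ih (by omega) (Fin.init w)
      rw [hT t ht] at this
      rw [pow_succ', mul_assoc]
      exact mul_le_mul_of_nonneg_left this hρ0.le
  have hjensen : ∀ (Q : Matrix (Fin n) (Fin n) ℝ), Q.PosDef → ∀ p t, t ≤ N → ∀ R : ℝ,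
      (∀ w, quadForm Q (y p t w) ≤ R) → quadForm Q (x (p * N + t)) ≤ R := by
    intro Q hQ p t ht R hR
    rw [hinterp p t ht]
    refine ((convexOn_quadForm hQ).map_sum_le (fun w _ => hβnn p t w) (hβsum p t)
      (fun _ _ => Set.mem_univ _)).trans ?_
    calc ∑ w, β p t w • quadForm Q (y p t w) ≤ ∑ w, β p t w * R :=
          Finset.sum_le_sum fun w _ => mul_le_mul_of_nonneg_left (hR w) (hβnn p t w)
      _ = R := by rw [← Finset.sum_mul, hβsum, one_mul]
  have hperiod : ∀ p, quadForm P (x (p * N)) ≤ ρ ^ (p * N) * quadForm P (x 0) := by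
    intro p
    induction p with
    | zero => simp
    | succ p ih =>
      have h := hjensen P hPpos p N le_rfl _ fun w => by
        have := hdecay p N le_rfl w
        rwa [hTN] at this
      rw [add_mul, one_mul, pow_add, mul_comm (ρ ^ (p * N)), mul_assoc]
      exact h.trans (mul_le_mul_of_nonneg_left ih (pow_nonneg hρ0.le _))
  have hsq : ∀ t, quadForm 1 (x t) ≤ C * ρ ^ t * quadForm 1 (x 0) := by
    intro t
    obtain ⟨p, k, hk, rfl⟩ : ∃ p k, k < N ∧ t = p * N + k :=
      ⟨t / N, t % N, Nat.mod_lt _ hN, (Nat.div_add_mod' t N).symm⟩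
    have h1nn : 0 ≤ quadForm 1 (x 0) := quadForm_nonneg PosDef.one _
    have hρk : 0 ≤ ρ ^ k := pow_nonneg hρ0.le _
    have ha0 : 0 ≤ max 0 a := le_max_left _ _
    calc quadForm 1 (x (p * N + k))
        ≤ max 0 a * (ρ ^ k * quadForm P (x (p * N))) := by
          refine hjensen 1 PosDef.one p k hk.le _ fun w => ?_
          refine (ha ⟨⟨k, by omega⟩, w⟩ _).trans ?_
          exact mul_le_mul (le_max_right _ _) (hdecay p k hk.le w)
            (quadForm_nonneg (hTpos k hk.le w).inv _) ha0
      _ ≤ max 0 a * (ρ ^ k * (ρ ^ (p * N) * (max 0 b * quadForm 1 (x 0)))) := by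
          gcongr
          refine (hperiod p).trans ?_
          gcongr
          exact (hb () _).trans (mul_le_mul_of_nonneg_right (le_max_right _ _) h1nn)
      _ = (max 0 a * max 0 b) * ρ ^ (p * N + k) * quadForm 1 (x 0) := by ring
      _ ≤ C * ρ ^ (p * N + k) * quadForm 1 (x 0) := by
          gcongr
          exact le_max_right _ _
  intro t
  rw [eNorm_eq, eNorm_eq]
  refine (Real.sqrt_le_sqrt (hsq t)).trans_eq ?_
  have hC0 : 0 ≤ C := zero_le_one.trans (le_max_left _ _)
  have hpow : Real.sqrt (ρ ^ t) = Real.sqrt ρ ^ t := by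
    rw [Real.sqrt_eq_iff_mul_self_eq (pow_nonneg hρ0.le _) (by positivity), ← mul_pow,
      Real.mul_self_sqrt hρ0.le]
  rw [Real.sqrt_mul (by positivity), Real.sqrt_mul hC0, hpow]
end

section
/- Let K ∈ ℝ^{m×n}, let F ∈ ℝ^{q×n} and E ∈ ℝ^{q×m}, and let N ≥ 1. Suppose symmetric positive definite matrices P^w ∈ ℝ^{n×n} for every word w of depth at most N−1, with P^∅ = P₀, satisfy P^w ≻ (Ā_i + B̄_i K)ᵀ P^{w·i} (Ā_i + B̄_i K) for every word w of depth at most N−2 and every i ∈ {1,…,d}, and P^w ≻ (Ā_i + B̄_i K)ᵀ P₀ (Ā_i + B̄_i K) for every word w of depth exactly N−1 and every i ∈ {1,…,d}; and suppose each ellipsoid E^w = {x ∈ ℝⁿ : xᵀ P^w x ≤ 1} is contained in X = {x ∈ ℝⁿ : (F + E K) x ≤ 1}. For t ∈ {0,…,N−1} let P̄_t denote the convex hull of the union of the sets E^w over all words w of depth t. Then: (i) P̄_t ⊆ X for every t ∈ {0,…,N−1}; (ii) for every x ∈ P̄_t with t ≤ N−2 and every (A, B) in the convex hull of {(Ā_i,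 B̄_i) : i ∈ {1,…,d}}, the point (A + B K) x lies in P̄_{t+1}; and (iii) for every x ∈ P̄_{N−1} and every (A, B) in that convex hull, the point (A + B K) x lies in {x : xᵀ P₀ x ≤ 1} ⊆ P̄_0. -/
open Matrix

/-- `P̄_t`: the convex hull of the union of the ellipsoids `{x : xᵀ P^w x ≤ 1}`
over all words `w` of depth `t`. -/
noncomputable def ellHull {n d : ℕ}
    (P : ∀ t : ℕ, (Fin t → Fin d) → Matrix (Fin n) (Fin n) ℝ) (t : ℕ) :
    Set (Fin n → ℝ) :=
  convexHull ℝ (⋃ w : Fin t → Fin d, {x : Fin n → ℝ | x ⬝ᵥ (P t w).mulVec x ≤ 1})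

/-- The unit sublevel set of a positive semidefinite quadratic form is convex. -/
lemma Matrix.PosSemidef.convex_ellipsoid {n : Type*} [Fintype n] {P : Matrix n n ℝ}
    (hP : P.PosSemidef) : Convex ℝ {x : n → ℝ | x ⬝ᵥ P.mulVec x ≤ 1} := by
  intro x hx y hy a b ha hb hab
  simp only [Set.mem_ofPred_eq] at hx hy ⊢
  have h : 0 ≤ (x - y) ⬝ᵥ P.mulVec (x - y) := by
    simpa using hP.dotProduct_mulVec_nonneg (x - y)
  simp only [mulVec_sub, mulVec_add, mulVec_smul, dotProduct_sub, sub_dotProduct,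
    dotProduct_add, add_dotProduct, dotProduct_smul, smul_dotProduct, smul_eq_mul] at h ⊢
  obtain rfl : b = 1 - a := by linarith
  nlinarith [mul_nonneg (mul_nonneg ha hb) h, mul_le_mul_of_nonneg_left hx ha,
    mul_le_mul_of_nonneg_left hy hb]

/-- If `Mᵀ Q M ≤ P` in the Loewner order, then `M` maps the ellipsoid of `P` into that of `Q`. -/
lemma Matrix.PosSemidef.mulVec_mem_ellipsoid {m n : Type*} [Fintype m] [Fintype n]
    {P : Matrix n n ℝ} {Q : Matrix m m ℝ} {M : Matrix m n ℝ}
    (h : (P - Mᵀ * Q * M).PosSemidef) {x : n → ℝ} (hx : x ⬝ᵥ P.mulVec x ≤ 1) :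
    M.mulVec x ⬝ᵥ Q.mulVec (M.mulVec x) ≤ 1 := by
  have h' : 0 ≤ x ⬝ᵥ (P - Mᵀ * Q * M).mulVec x := by
    simpa using h.dotProduct_mulVec_nonneg x
  rw [sub_mulVec, dotProduct_sub, ← mulVec_mulVec, ← mulVec_mulVec, dotProduct_mulVec x Mᵀ,
    vecMul_transpose] at h'
  linarith

/-- If every vertex closed loop `A i + B i * K` maps `S` into a convex set `C`, then every
convex combination of them maps the convex hull of `S` into `C`. -/
lemma closedLoop_mulVec_mem_of_mem_convexHull {ι m n : Type*} [Fintype ι] [Fintype m]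
    [Fintype n] {A : ι → Matrix n n ℝ} {B : ι → Matrix n m ℝ} {K : Matrix m n ℝ}
    {S C : Set (n → ℝ)} (hC : Convex ℝ C)
    (h : ∀ i, ∀ x ∈ S, (A i + B i * K).mulVec x ∈ C) {x : n → ℝ} (hx : x ∈ convexHull ℝ S)
    {a : ι → ℝ} (ha : ∀ i, 0 ≤ a i) (hsum : ∑ i, a i = 1) :
    ((∑ i, a i • A i) + (∑ i, a i • B i) * K).mulVec x ∈ C := by
  have hi (i : ι) : (A i + B i * K).mulVec x ∈ C :=
    convexHull_min (h i) (hC.linear_preimage (A i + B i * K).mulVecLin) hx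
  have heq : ((∑ i, a i • A i) + (∑ i, a i • B i) * K).mulVec x =
      ∑ i, a i • (A i + B i * K).mulVec x := by
    simp only [Matrix.sum_mul, ← Finset.sum_add_distrib, sum_mulVec, smul_mul, ← smul_add,
      smul_mulVec]
  rw [heq]
  exact hC.sum_mem (fun i _ => ha i) hsum fun i _ => hi i

theorem stmt_16 (n m d q : ℕ) (hn : 0 < n) (hm : 0 < m) (hd : 0 < d) (hq : 0 < q)
    (Abar : Fin d → Matrix (Fin n) (Fin n) ℝ)
    (Bbar : Fin d → Matrix (Fin n) (Fin m) ℝ)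
    (K : Matrix (Fin m) (Fin n) ℝ)
    (F : Matrix (Fin q) (Fin n) ℝ) (E : Matrix (Fin q) (Fin m) ℝ)
    (N : ℕ) (hN : 1 ≤ N)
    (P0 : Matrix (Fin n) (Fin n) ℝ)
    (P : ∀ t : ℕ, (Fin t → Fin d) → Matrix (Fin n) (Fin n) ℝ)
    (hP0 : ∀ w : Fin 0 → Fin d, P 0 w = P0)
    (hPpos : ∀ t, t < N → ∀ w : Fin t → Fin d, (P t w).PosDef)
    (h1 : ∀ t, t + 2 ≤ N → ∀ (w : Fin t → Fin d) (i : Fin d),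
      (P t w - (Abar i + Bbar i * K)ᵀ * P (t + 1) (Fin.snoc w i) *
        (Abar i + Bbar i * K)).PosDef)
    (h2 : ∀ (w : Fin (N - 1) → Fin d) (i : Fin d),
      (P (N - 1) w - (Abar i + Bbar i * K)ᵀ * P0 * (Abar i + Bbar i * K)).PosDef)
    -- each ellipsoid is contained in the constraint set `X`
    (hcont : ∀ t, t < N → ∀ w : Fin t → Fin d,
      {x : Fin n → ℝ | x ⬝ᵥ (P t w).mulVec x ≤ 1} ⊆
        {x : Fin n → ℝ | ∀ j : Fin q, ((F + E * K).mulVec x) j ≤ 1}) :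
    -- (i)
    (∀ t, t < N → ellHull P t ⊆
      {x : Fin n → ℝ | ∀ j : Fin q, ((F + E * K).mulVec x) j ≤ 1}) ∧
    -- (ii)
    (∀ t, t + 2 ≤ N → ∀ x ∈ ellHull P t,
      ∀ a : Fin d → ℝ, (∀ i, 0 ≤ a i) → (∑ i, a i) = 1 →
        ((∑ i, a i • Abar i) + (∑ i, a i • Bbar i) * K).mulVec x ∈ ellHull P (t + 1)) ∧
    -- (iii)
    (∀ x ∈ ellHull P (N - 1),
      ∀ a : Fin d → ℝ, (∀ i, 0 ≤ a i) → (∑ i, a i) = 1 →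
        ((∑ i, a i • Abar i) + (∑ i, a i • Bbar i) * K).mulVec x ∈
          {y : Fin n → ℝ | y ⬝ᵥ P0.mulVec y ≤ 1} ∧
        {y : Fin n → ℝ | y ⬝ᵥ P0.mulVec y ≤ 1} ⊆ ellHull P 0) := by
  have hP0' : P0.PosSemidef := hP0 Fin.elim0 ▸ (hPpos 0 hN Fin.elim0).posSemidef
  refine ⟨fun t ht => convexHull_min (Set.iUnion_subset (hcont t ht)) ?_,
    fun t ht x hx a ha hsum => ?_, fun x hx a ha hsum => ⟨?_, fun y hy => ?_⟩⟩
  · have hX : Convex ℝ {y : Fin q → ℝ | ∀ j, y j ≤ 1} := convex_Iic (fun _ : Fin q => (1 : ℝ))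
    exact hX.linear_preimage (F + E * K).mulVecLin
  · refine closedLoop_mulVec_mem_of_mem_convexHull (convex_convexHull ℝ _) (fun i y hy => ?_)
      hx ha hsum
    obtain ⟨w, hw⟩ := Set.mem_iUnion.1 hy
    exact subset_convexHull ℝ _
      (Set.mem_iUnion.2 ⟨_, (h1 t ht w i).posSemidef.mulVec_mem_ellipsoid hw⟩)
  · refine closedLoop_mulVec_mem_of_mem_convexHull hP0'.convex_ellipsoid (fun i y hy => ?_)
      hx ha hsum
    obtain ⟨w, hw⟩ := Set.mem_iUnion.1 hy
    exact (h2 w i).posSemidef.mulVec_mem_ellipsoid hw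
  · refine subset_convexHull ℝ _ (Set.mem_iUnion.2 ⟨Fin.elim0, ?_⟩)
    rwa [hP0]
end

section
/- Let F ∈ ℝ^{q×n}, E ∈ ℝ^{q×m}, N ≥ 1, and gains K^w ∈ ℝ^{m×n} for every word w of depth at most N−1. Suppose symmetric positive definite matrices P^w ∈ ℝ^{n×n} for every word w of depth at most N−1, with P^∅ = P₀, satisfy P^w ≻ (Ā_i + B̄_i K^w)ᵀ P^{w·i} (Ā_i + B̄_i K^w) for every word w of depth at most N−2 and every i ∈ {1,…,d}, and P^w ≻ (Ā_i + B̄_i K^w)ᵀ P₀ (Ā_i + B̄_i K^w) for every word w of depth exactly N−1 and every i ∈ {1,…,d}; and suppose each ellipsoid E^w = {x ∈ ℝⁿ : xᵀ P^w x ≤ 1} satisfies E^w ⊆ {x ∈ ℝⁿ : (F + E K^w) x ≤ 1}. For t ∈ {0,…,N−1} let P̄_t denote the convex hull of the union of the sets E^w over all words w of depth t. Fix t ∈ {0,…,N−1} and x ∈ P̄_t, so that x = Σ_{|w|=t} β^w x^w for some points x^w ∈ E^w and nonnegative weights β^w summing to 1; let u = Σ_{|w|=t} β^w K^w x^w. Then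 F x + E u ≤ 1, and for every (A, B) in the convex hull of {(Ā_i, B̄_i) : i ∈ {1,…,d}}: if t ≤ N−2 then A x + B u ∈ P̄_{t+1}, and if t = N−1 then A x + B u ∈ {x : xᵀ P₀ x ≤ 1} ⊆ P̄_0. -/
open Matrix

/-- The unit sublevel set of a positive semidefinite quadratic form is convex. -/
theorem convex_setOf_dotProduct_mulVec_le_one {n : ℕ} {Q : Matrix (Fin n) (Fin n) ℝ}
    (hQ : Q.PosSemidef) : Convex ℝ {x : Fin n → ℝ | x ⬝ᵥ Q.mulVec x ≤ 1} := by
  intro x hx y hy a b ha hb hab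
  simp only [Set.mem_ofPred_eq] at hx hy ⊢
  have h : 0 ≤ (x - y) ⬝ᵥ Q.mulVec (x - y) := by
    simpa using hQ.dotProduct_mulVec_nonneg (x - y)
  simp only [mulVec_sub, mulVec_add, mulVec_smul, sub_dotProduct, dotProduct_sub,
    add_dotProduct, dotProduct_add, smul_dotProduct, dotProduct_smul, smul_eq_mul] at h ⊢
  obtain rfl : b = 1 - a := by linarith
  nlinarith [mul_nonneg (mul_nonneg ha hb) h, mul_le_mul_of_nonneg_left hx ha,
    mul_le_mul_of_nonneg_left hy hb]

/-- If `R ≻ Mᵀ Q M`, then `M` maps the unit sublevel set of `R` into that of `Q`. -/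
theorem dotProduct_mulVec_mulVec_le_one {n : ℕ} {R Q M : Matrix (Fin n) (Fin n) ℝ}
    (h : (R - Mᵀ * Q * M).PosDef) {x : Fin n → ℝ} (hx : x ⬝ᵥ R.mulVec x ≤ 1) :
    M.mulVec x ⬝ᵥ Q.mulVec (M.mulVec x) ≤ 1 := by
  have h0 : 0 ≤ x ⬝ᵥ (R - Mᵀ * Q * M).mulVec x := by
    simpa using h.posSemidef.dotProduct_mulVec_nonneg x
  rw [sub_mulVec, dotProduct_sub, ← mulVec_mulVec, ← mulVec_mulVec,
    dotProduct_mulVec x Mᵀ, vecMul_transpose] at h0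
  linarith

/-- Feedback applied at the points of a convex combination is the convex combination of the
closed-loop images. -/
theorem mulVec_sum_add_mulVec_sum {k n m : ℕ} {ι : Type*} [Fintype ι]
    (A : Matrix (Fin k) (Fin n) ℝ) (B : Matrix (Fin k) (Fin m) ℝ)
    (K : ι → Matrix (Fin m) (Fin n) ℝ) (β : ι → ℝ) (y : ι → Fin n → ℝ) :
    A.mulVec (∑ w, β w • y w) + B.mulVec (∑ w, β w • (K w).mulVec (y w)) =
      ∑ w, β w • (A + B * K w).mulVec (y w) := by
  simp only [mulVec_sum, mulVec_smul, mulVec_mulVec, add_mulVec, smul_add,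
    Finset.sum_add_distrib]

/-- A convex set containing all closed-loop images under the vertices contains the successor state
for every convex combination of the vertices. -/
theorem sum_smul_mulVec_add_mem {n m d : ℕ} {ι : Type*} [Fintype ι]
    {A : Fin d → Matrix (Fin n) (Fin n) ℝ} {B : Fin d → Matrix (Fin n) (Fin m) ℝ}
    {K : ι → Matrix (Fin m) (Fin n) ℝ} {β : ι → ℝ} {y : ι → Fin n → ℝ}
    {S : Set (Fin n → ℝ)} (hS : Convex ℝ S) (hβ : ∀ w, 0 ≤ β w) (hβs : ∑ w, β w = 1)
    (h : ∀ i w, (A i + B i * K w).mulVec (y w) ∈ S)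
    {a : Fin d → ℝ} (ha : ∀ i, 0 ≤ a i) (has : ∑ i, a i = 1) :
    (∑ i, a i • A i).mulVec (∑ w, β w • y w) +
      (∑ i, a i • B i).mulVec (∑ w, β w • (K w).mulVec (y w)) ∈ S := by
  have key : (∑ i, a i • A i).mulVec (∑ w, β w • y w) +
      (∑ i, a i • B i).mulVec (∑ w, β w • (K w).mulVec (y w)) =
      ∑ i, a i • ∑ w, β w • (A i + B i * K w).mulVec (y w) := by
    simp only [← mulVec_sum_add_mulVec_sum, smul_add, Finset.sum_add_distrib, sum_mulVec,
      smul_mulVec]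
  rw [key]
  exact hS.sum_mem (fun i _ => ha i) has fun i _ =>
    hS.sum_mem (fun w _ => hβ w) hβs fun w _ => h i w

theorem stmt_17 (n m d q : ℕ) (hn : 0 < n) (hm : 0 < m) (hd : 0 < d) (hq : 0 < q)
    (Abar : Fin d → Matrix (Fin n) (Fin n) ℝ)
    (Bbar : Fin d → Matrix (Fin n) (Fin m) ℝ)
    (F : Matrix (Fin q) (Fin n) ℝ) (E : Matrix (Fin q) (Fin m) ℝ)
    (N : ℕ) (hN : 1 ≤ N)
    (K : ∀ t : ℕ, (Fin t → Fin d) → Matrix (Fin m) (Fin n) ℝ)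
    (P0 : Matrix (Fin n) (Fin n) ℝ)
    (P : ∀ t : ℕ, (Fin t → Fin d) → Matrix (Fin n) (Fin n) ℝ)
    (hP0 : ∀ w : Fin 0 → Fin d, P 0 w = P0)
    (hPpos : ∀ t, t < N → ∀ w : Fin t → Fin d, (P t w).PosDef)
    (h1 : ∀ t, t + 2 ≤ N → ∀ (w : Fin t → Fin d) (i : Fin d),
      (P t w - (Abar i + Bbar i * K t w)ᵀ * P (t + 1) (Fin.snoc w i) *
        (Abar i + Bbar i * K t w)).PosDef)
    (h2 : ∀ (w : Fin (N - 1) → Fin d) (i : Fin d),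
      (P (N - 1) w - (Abar i + Bbar i * K (N - 1) w)ᵀ * P0 *
        (Abar i + Bbar i * K (N - 1) w)).PosDef)
    -- each ellipsoid is contained in the corresponding constraint set
    (hcont : ∀ t, t < N → ∀ w : Fin t → Fin d,
      {x : Fin n → ℝ | x ⬝ᵥ (P t w).mulVec x ≤ 1} ⊆
        {x : Fin n → ℝ | ∀ j : Fin q, ((F + E * K t w).mulVec x) j ≤ 1})
    -- a point of `P̄_t` together with its convex decomposition, and the interpolated input
    (t : ℕ) (ht : t < N)
    (x : Fin n → ℝ) (xw : (Fin t → Fin d) → Fin n → ℝ) (β : (Fin t → Fin d) → ℝ)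
    (hxw : ∀ w, xw w ⬝ᵥ (P t w).mulVec (xw w) ≤ 1)
    (hβ : ∀ w, 0 ≤ β w) (hβs : (∑ w : Fin t → Fin d, β w) = 1)
    (hx : x = ∑ w : Fin t → Fin d, β w • xw w)
    (u : Fin m → ℝ)
    (hu : u = ∑ w : Fin t → Fin d, β w • (K t w).mulVec (xw w)) :
    (∀ j : Fin q, (F.mulVec x + E.mulVec u) j ≤ 1) ∧
    (∀ a : Fin d → ℝ, (∀ i, 0 ≤ a i) → (∑ i, a i) = 1 →
      (t + 2 ≤ N →
        (∑ i, a i • Abar i).mulVec x + (∑ i, a i • Bbar i).mulVec u ∈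
          ellHull P (t + 1)) ∧
      (t = N - 1 →
        (∑ i, a i • Abar i).mulVec x + (∑ i, a i • Bbar i).mulVec u ∈
          {y : Fin n → ℝ | y ⬝ᵥ P0.mulVec y ≤ 1} ∧
        {y : Fin n → ℝ | y ⬝ᵥ P0.mulVec y ≤ 1} ⊆ ellHull P 0)) := by
  subst hx hu
  refine ⟨fun j => ?_, fun a ha has => ⟨fun htN => ?_, ?_⟩⟩
  · rw [mulVec_sum_add_mulVec_sum, Finset.sum_apply, ← hβs]
    refine Finset.sum_le_sum fun w _ => ?_
    exact mul_le_of_le_one_right (hβ w) (hcont t ht w (hxw w) j)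
  · refine sum_smul_mulVec_add_mem (convex_convexHull ℝ _) hβ hβs (fun i w => ?_) ha has
    exact subset_convexHull ℝ _ (Set.mem_iUnion.2
      ⟨Fin.snoc w i, dotProduct_mulVec_mulVec_le_one (h1 t htN w i) (hxw w)⟩)
  · rintro rfl
    have hP0pos : P0.PosDef := hP0 Fin.elim0 ▸ hPpos 0 hN Fin.elim0
    refine ⟨sum_smul_mulVec_add_mem (convex_setOf_dotProduct_mulVec_le_one hP0pos.posSemidef)
      hβ hβs (fun i w => dotProduct_mulVec_mulVec_le_one (h2 w i) (hxw w)) ha has, ?_⟩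
    intro y hy
    refine subset_convexHull ℝ _ (Set.mem_iUnion.2 ⟨Fin.elim0, ?_⟩)
    rwa [hP0]
end
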